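/- Let r ≥ 1, M > 0, and let h be a concave-function transformation such that g = h^{1/2} is also a concave-function transformation satisfying g′(y) = o(|y|^{−(α+1)}) as y → −∞ with α > 1/r (plus conditions T.2–T.4). Then log N_{[]}(ε, P_{M,h}^{1/2}, L_r) ≤ K_{r,M,h} ε^{−1/2} for all ε > 0, where K_{r,M,h} depends only on r, M, h. -/

import Mathlib

open MeasureTheory Filter
open scoped ENNReal

/-- Concavity for extended-real-valued functions on ℝ. -/
def ConcaveE (φ : ℝ → EReal) : Prop :=
  ∀ x y θ : ℝ, 0 ≤ θ → θ ≤ 1 →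
    ((1 - θ : ℝ) : EReal) * φ x + (θ : EReal) * φ y ≤ φ ((1 - θ) * x + θ * y)

/-- A concave-function transformation. -/
structure ConcaveTransform where
  toFun : EReal → ℝ≥0∞
  mono : Monotone toFun
  cont : Continuous toFun
  map_bot : toFun ⊥ = 0
  map_top : toFun ⊤ = ⊤
  deriv' : ℝ → ℝ
  hasDeriv : ∀ y : ℝ, toFun (y : EReal) ≠ ⊤ →
    HasDerivAt (fun t : ℝ => (toFun (t : EReal)).toReal) (deriv' y) y
  derivCont : ContinuousOn deriv' {y : ℝ | toFun (y : EReal) ≠ ⊤}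

/-- The class `P_h` of `h`-concave-transformed probability densities on ℝ. -/
def Pdens (h : ConcaveTransform) : Set (ℝ → ℝ≥0∞) :=
  {p | ∃ φ : ℝ → EReal, ConcaveE φ ∧ (∀ x, p x = h.toFun (φ x)) ∧ (∫⁻ x, p x = 1)}

/-- `P_{M,h}`: members of `P_h` bounded above by `M` and below by `1/M` on `[-1,1]`. -/
def PMh (h : ConcaveTransform) (M : ℝ) : Set (ℝ → ℝ≥0∞) :=
  {p | p ∈ Pdens h ∧ (∀ x, p x ≤ ENNReal.ofReal M) ∧
       (∀ x : ℝ, |x| ≤ 1 → ENNReal.ofReal (1 / M) ≤ p x)}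

/-- `P_{M,h}^{1/2}`: square roots of members of `P_{M,h}`. -/
def sqrtPMh (h : ConcaveTransform) (M : ℝ) : Set (ℝ → ℝ) :=
  {f | ∃ p ∈ PMh h M, ∀ x, f x = Real.sqrt ((p x).toReal)}

/-- `BrackR F ε r N`: `N` brackets of `L_r(ℝ)`-size at most `ε` covering `F`. -/
def BrackR (F : Set (ℝ → ℝ)) (ε r : ℝ) (N : ℕ) : Prop :=
  ∃ l u : Fin N → ℝ → ℝ,
    (∀ i, ∫⁻ x, ENNReal.ofReal (|u i x - l i x| ^ r) ≤ ENNReal.ofReal (ε ^ r)) ∧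
    ∀ f ∈ F, ∃ i, ∀ x, l i x ≤ f x ∧ f x ≤ u i x

/-- Colouring with at most `exp L` colours such that equally coloured members are `R`-related. -/
def Col {X : Type*} (F : Set X) (R : X → X → Prop) (L : ℝ) : Prop :=
  ∃ c : X → ℕ, (∀ a ∈ F, (c a : ℝ) + 1 ≤ Real.exp L) ∧
    ∀ a ∈ F, ∀ b ∈ F, c a = c b → R a b

theorem Col.mono {X : Type*} {F : Set X} {R R' : X → X → Prop} {L L' : ℝ}
    (h : Col F R L) (hL : L ≤ L') (hR : ∀ a ∈ F, ∀ b ∈ F, R a b → R' a b) : Col F R' L' := by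
  obtain ⟨c, h1, h2⟩ := h
  exact ⟨c, fun a ha => (h1 a ha).trans (Real.exp_le_exp.2 hL),
    fun a ha b hb hc => hR a ha b hb (h2 a ha b hb hc)⟩

theorem Col.comap {X Y : Type*} {F : Set X} {G : Set Y} {R : Y → Y → Prop} {L : ℝ}
    (h : Col G R L) (π : X → Y) (hπ : ∀ a ∈ F, π a ∈ G) :
    Col F (fun a b => R (π a) (π b)) L := by
  obtain ⟨c, h1, h2⟩ := h
  exact ⟨fun a => c (π a), fun a ha => h1 _ (hπ a ha),
    fun a ha b hb hc => h2 _ (hπ a ha) _ (hπ b hb) hc⟩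

theorem Col.trivial {X : Type*} {F : Set X} {R : X → X → Prop} {L : ℝ} (hL : 0 ≤ L)
    (h : ∀ a ∈ F, ∀ b ∈ F, R a b) : Col F R L :=
  ⟨fun _ => 0, fun a _ => by simpa using hL, fun a ha b hb _ => h a ha b hb⟩

theorem Col.and {X : Type*} {F : Set X} {R R' : X → X → Prop} {L L' : ℝ}
    (h : Col F R L) (h' : Col F R' L') : Col F (fun a b => R a b ∧ R' a b) (L + L') := by
  obtain ⟨c, h1, h2⟩ := h
  obtain ⟨c', h1', h2'⟩ := h'
  set N : ℕ := ⌊Real.exp L'⌋₊ with hN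
  have hc' : ∀ a ∈ F, c' a < N := by
    intro a ha
    have := h1' a ha
    rw [hN, ← Nat.succ_le_iff]
    apply Nat.le_floor
    push_cast
    exact this
  refine ⟨fun a => c a * N + c' a, ?_, ?_⟩
  · intro a ha
    have e1 := h1 a ha
    have e2 : ((c' a : ℝ)) + 1 ≤ N := by exact_mod_cast hc' a ha
    have e3 : (N : ℝ) ≤ Real.exp L' := Nat.floor_le (Real.exp_pos _).le
    rw [Real.exp_add]
    push_cast
    calc (c a : ℝ) * N + c' a + 1 ≤ ((c a : ℝ) + 1) * N := by linarith
      _ ≤ Real.exp L * Real.exp L' := by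
        apply mul_le_mul e1 e3 (by positivity) (Real.exp_pos _).le
  · intro a ha b hb hab
    have ha' := hc' a ha
    have hb' := hc' b hb
    have hNpos : 0 < N := by omega
    have e1 : c a = c b := by
      have := congrArg (· / N) hab
      simpa [Nat.add_div_of_dvd_right, Nat.mul_div_cancel _ hNpos, Nat.div_eq_of_lt ha',
        Nat.div_eq_of_lt hb', Nat.mul_add_div, mul_comm _ N, hNpos] using this
    have e2 : c' a = c' b := by
      simp only [e1] at hab
      omega
    exact ⟨h2 a ha b hb e1, h2' a ha b hb e2⟩

theorem Col.forall_lt {X : Type*} {F : Set X} {R : ℕ → X → X → Prop} {L : ℕ → ℝ} (K : ℕ)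
    (h : ∀ k < K, Col F (R k) (L k)) :
    Col F (fun a b => ∀ k < K, R k a b) (∑ k ∈ Finset.range K, L k) := by
  induction K with
  | zero => exact Col.trivial (by simp) (by simp)
  | succ K ih =>
    rw [Finset.sum_range_succ]
    refine ((ih fun k hk => h k (by omega)).and (h K (by omega))).mono le_rfl ?_
    rintro a _ b _ ⟨h1, h2⟩ k hk
    rcases Nat.lt_succ_iff_lt_or_eq.1 hk with h3 | rfl
    · exact h1 k h3
    · exact h2

theorem Col.of_code {X γ : Type*} {F : Set X} (code : X → γ) (S : Set γ) (hS : S.Finite) {L : ℝ}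
    (hcard : (S.ncard : ℝ) ≤ Real.exp L) (hF : ∀ a ∈ F, code a ∈ S) :
    Col F (fun a b => code a = code b) L := by
  classical
  have : Finite S := hS
  obtain ⟨n, ⟨e⟩⟩ := Finite.exists_equiv_fin S
  have hn : S.ncard = n := by
    rw [← Nat.card_coe_set_eq, Nat.card_congr e]; simp
  refine ⟨fun a => if h : code a ∈ S then (e ⟨code a, h⟩ : ℕ) else 0, ?_, ?_⟩
  · intro a ha
    simp only [hF a ha, dif_pos]
    have := (e ⟨code a, hF a ha⟩).2
    refine le_trans ?_ hcard
    rw [hn]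
    exact_mod_cast this
  · intro a ha b hb hab
    simp only [hF a ha, hF b hb, dif_pos] at hab
    have := e.injective (Fin.ext hab)
    simpa using this

/-- Dependent colouring. -/
theorem Col.dep {X γ : Type*} {F : Set X} (key : X → γ) {R : X → X → Prop} {L : ℝ}
    (h : ∀ κ, Col {a ∈ F | key a = κ} R L) :
    Col F (fun a b => key a = key b → R a b) L := by
  choose c h1 h2 using h
  refine ⟨fun a => c (key a) a, fun a ha => h1 _ a ⟨ha, rfl⟩, ?_⟩
  intro a ha b hb hab hk
  refine h2 (key b) a ⟨ha, hk⟩ b ⟨hb, rfl⟩ ?_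
  simpa [hk] using hab

/-- The logarithmic weight. -/
noncomputable def LL (t : ℝ) : ℝ := -Real.log (1 - Real.exp (-t))

theorem LL_nonneg {t : ℝ} (ht : 0 < t) : 0 ≤ LL t := by
  unfold LL
  have h1 : Real.exp (-t) < 1 := by simpa using ht
  have h2 := Real.exp_pos (-t)
  have := Real.log_nonpos (x := 1 - Real.exp (-t)) (by linarith) (by linarith)
  linarith

theorem LL_le_one {t : ℝ} (ht : 0 < t) : LL t ≤ 2 * t ^ (-(1/2) : ℝ) := by
  have h1 : Real.exp (-t) < 1 := by simpa using ht
  have h3 : t / (1 + t) ≤ 1 - Real.exp (-t) := by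
    have : Real.exp (-t) ≤ 1 / (1 + t) := by
      rw [Real.exp_neg, ← one_div]
      apply one_div_le_one_div_of_le (by linarith)
      linarith [Real.add_one_le_exp t]
    have e : t / (1 + t) = 1 - 1 / (1 + t) := by field_simp; ring
    rw [e]; linarith
  set v := t ^ (-(1/2) : ℝ) with hv
  have hvpos : 0 < v := Real.rpow_pos_of_pos ht _
  have hv2 : v ^ 2 * t = 1 := by
    rw [hv, ← Real.rpow_natCast, ← Real.rpow_mul ht.le]
    norm_num
    rw [Real.rpow_neg_one]
    field_simp
  have h4 : LL t ≤ Real.log ((1 + v) ^ 2) := by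
    unfold LL
    rw [← Real.log_inv]
    apply Real.log_le_log
    · apply inv_pos.2; linarith
    · calc (1 - Real.exp (-t))⁻¹ ≤ (t / (1 + t))⁻¹ := inv_anti₀ (by positivity) h3
        _ = 1 + v ^ 2 := by
          rw [inv_div]
          field_simp
          linarith
        _ ≤ (1 + v) ^ 2 := by nlinarith
  refine h4.trans ?_
  rw [Real.log_pow]
  have := Real.log_le_sub_one_of_pos (x := 1 + v) (by linarith)
  push_cast
  linarith

theorem LL_le_two {t : ℝ} (ht : 0 < t) : LL t ≤ 24 * t ^ (-4 : ℝ) := by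
  have h1 : Real.exp (-t) < 1 := by simpa using ht
  have h0 := Real.exp_pos t
  have h2 : t ^ 4 / 24 ≤ Real.exp t - 1 := by
    have := Real.sum_le_exp_of_nonneg ht.le 5
    simp [Finset.sum_range_succ, Nat.factorial] at this
    have : 0 ≤ t + t ^ 2 / 2 + t ^ 3 / 6 := by positivity
    linarith
  unfold LL
  rw [← Real.log_inv]
  have h3 := Real.log_le_sub_one_of_pos (x := (1 - Real.exp (-t))⁻¹)
    (inv_pos.2 (by linarith))
  have h5 : 0 < Real.exp t - 1 := lt_of_lt_of_le (by positivity) h2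
  have h4 : (1 - Real.exp (-t))⁻¹ - 1 = (Real.exp t - 1)⁻¹ := by
    rw [Real.exp_neg]
    have : 1 - (Real.exp t)⁻¹ = (Real.exp t - 1) / Real.exp t := by field_simp
    rw [this, inv_div]
    field_simp
    ring
  have h6 : (Real.exp t - 1)⁻¹ ≤ (t ^ 4 / 24)⁻¹ := inv_anti₀ (by positivity) h2
  have h7 : (t ^ 4 / 24)⁻¹ = 24 * t ^ (-4 : ℝ) := by
    rw [Real.rpow_neg ht.le]
    norm_num
    field_simp
  linarith

/-- Kraft-type counting of weighted integer vectors. -/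
theorem kraft_count {m : ℕ} (lam : Fin m → ℝ) (hl : ∀ i, 0 < lam i) (T : ℝ) :
    {n : Fin m → ℕ | ∑ i, lam i * n i ≤ T}.Finite ∧
    (({n : Fin m → ℕ | ∑ i, lam i * n i ≤ T}.ncard : ℕ) : ℝ) ≤
      Real.exp (T + ∑ i, LL (lam i)) := by
  classical
  obtain ⟨Q, hQ⟩ : ∃ Q : ℕ, ∀ i, T / lam i < Q := by
    have : ∀ i, ∃ q : ℕ, T / lam i < q := fun i => exists_nat_gt _
    choose q hq using this
    refine ⟨∑ i, q i, fun i => (hq i).trans_le ?_⟩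
    exact_mod_cast Finset.single_le_sum (f := q) (fun _ _ => Nat.zero_le _) (Finset.mem_univ i)
  set S := {n : Fin m → ℕ | ∑ i, lam i * n i ≤ T} with hS
  set P := Fintype.piFinset (fun _ : Fin m => Finset.range Q) with hP
  have hsub : S ⊆ (P : Set (Fin m → ℕ)) := by
    intro n hn
    simp only [hP, Finset.mem_coe, Fintype.mem_piFinset, Finset.mem_range]
    intro i
    have h1 : lam i * n i ≤ T := by
      refine le_trans ?_ hn
      exact Finset.single_le_sum (f := fun i => lam i * (n i : ℝ))
        (fun j _ => mul_nonneg (hl j).le (Nat.cast_nonneg _)) (Finset.mem_univ i)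
    have h2 : (n i : ℝ) ≤ T / lam i := by
      rw [le_div_iff₀ (hl i)]; linarith
    exact_mod_cast h2.trans_lt (hQ i)
  have hfin : S.Finite := P.finite_toSet.subset hsub
  refine ⟨hfin, ?_⟩
  have hcard : S.ncard = (P.filter (fun n => n ∈ S)).card := by
    rw [← Set.ncard_coe_finset]
    congr 1
    ext n
    simp only [Finset.coe_filter, Set.mem_ofPred_eq]
    exact ⟨fun h => ⟨hsub h, h⟩, fun h => h.2⟩
  have h1 : ((P.filter (fun n => n ∈ S)).card : ℝ) * Real.exp (-T) ≤
      ∑ n ∈ P, ∏ i, Real.exp (-lam i) ^ (n i) := by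
    calc ((P.filter (fun n => n ∈ S)).card : ℝ) * Real.exp (-T)
        = ∑ n ∈ P.filter (fun n => n ∈ S), Real.exp (-T) := by simp
      _ ≤ ∑ n ∈ P.filter (fun n => n ∈ S), ∏ i, Real.exp (-lam i) ^ (n i) := by
          apply Finset.sum_le_sum
          intro n hn
          have hn' : ∑ i, lam i * n i ≤ T := (Finset.mem_filter.1 hn).2
          simp_rw [← Real.exp_nat_mul]
          rw [← Real.exp_sum]
          apply Real.exp_le_exp.2
          have : ∑ i, (n i : ℝ) * -lam i = - ∑ i, lam i * n i := by
            rw [← Finset.sum_neg_distrib]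
            exact Finset.sum_congr rfl fun i _ => by ring
          rw [this]; linarith
      _ ≤ _ := Finset.sum_le_sum_of_subset_of_nonneg (Finset.filter_subset _ _)
          (fun n _ _ => Finset.prod_nonneg fun i _ => by positivity)
  have h2 : ∑ n ∈ P, ∏ i, Real.exp (-lam i) ^ (n i) =
      ∏ i, ∑ n ∈ Finset.range Q, Real.exp (-lam i) ^ n := by
    rw [Finset.prod_univ_sum]
  have h3 : ∏ i, ∑ n ∈ Finset.range Q, Real.exp (-lam i) ^ n ≤
      ∏ i, Real.exp (LL (lam i)) := by
    apply Finset.prod_le_prod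
    · intro i _; positivity
    · intro i _
      have hx : Real.exp (-lam i) < 1 := by simpa using hl i
      have hpos : 0 < 1 - Real.exp (-lam i) := by linarith
      unfold LL
      rw [Real.exp_neg (Real.log _), Real.exp_log hpos]
      have := (summable_geometric_of_lt_one (Real.exp_pos (-lam i)).le hx).sum_le_tsum
        (Finset.range Q) (fun _ _ => by positivity)
      rwa [tsum_geometric_of_lt_one (Real.exp_pos (-lam i)).le hx] at this
  rw [← Real.exp_sum] at h3
  rw [hcard, Real.exp_add]
  have h4 := (h1.trans h2.le).trans h3
  rw [Real.exp_neg] at h4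
  have h5 := Real.exp_pos T
  have : ((P.filter (fun n => n ∈ S)).card : ℝ) =
    ((P.filter (fun n => n ∈ S)).card : ℝ) * (Real.exp T)⁻¹ * Real.exp T := by field_simp
  rw [this, mul_comm (Real.exp T)]
  exact mul_le_mul_of_nonneg_right h4 h5.le

theorem sum_inv_sqrt (m : ℕ) :
    ∑ i ∈ Finset.range m, ((i : ℝ) + 1) ^ (-(1/2) : ℝ) ≤ 2 * Real.sqrt m := by
  induction m with
  | zero => simp
  | succ m ih =>
    rw [Finset.sum_range_succ]
    have h1 : ((m : ℝ) + 1) ^ (-(1/2) : ℝ) = (Real.sqrt (m + 1))⁻¹ := by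
      rw [Real.rpow_neg (by positivity), Real.sqrt_eq_rpow]
    rw [h1]
    push_cast
    set a := Real.sqrt m
    set b := Real.sqrt (m + 1)
    have ha : 0 ≤ a := Real.sqrt_nonneg _
    have hb : 0 < b := Real.sqrt_pos.2 (by positivity)
    have ha2 : a ^ 2 = m := Real.sq_sqrt (by positivity)
    have hb2 : b ^ 2 = m + 1 := Real.sq_sqrt (by positivity)
    have h2 : b⁻¹ ≤ 2 * (b - a) := by
      rw [inv_le_iff_one_le_mul₀ hb]
      nlinarith [sq_nonneg (b - a)]
    linarith

/-- Comparison function. -/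
noncomputable def ff (s j : ℝ) : ℝ := if j ≤ s then (j / s) ^ (-(1/2) : ℝ) else (s / j) ^ 2

theorem ff_nonneg {s j : ℝ} (hs : 0 < s) (hj : 0 < j) : 0 ≤ ff s j := by
  unfold ff; split_ifs <;> positivity

theorem sum_ff {s : ℝ} (hs : 1 ≤ s) (m : ℕ) :
    ∑ i ∈ Finset.range m, ff s ((i : ℝ) + 1) ≤ 4 * s := by
  have hs0 : 0 < s := by linarith
  have key1 : (m : ℝ) ≤ s → ∑ i ∈ Finset.range m, ff s ((i : ℝ) + 1) ≤ 2 * s := by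
    intro hm
    have : ∀ i ∈ Finset.range m, ff s ((i : ℝ) + 1) =
        s ^ (1/2 : ℝ) * ((i : ℝ) + 1) ^ (-(1/2) : ℝ) := by
      intro i hi
      have hi' : (i : ℝ) + 1 ≤ m := by exact_mod_cast Finset.mem_range.1 hi
      unfold ff
      rw [if_pos (by linarith), Real.div_rpow (by positivity) hs0.le, Real.rpow_neg hs0.le]
      field_simp
    rw [Finset.sum_congr rfl this, ← Finset.mul_sum, ← Real.sqrt_eq_rpow]
    have h1 := sum_inv_sqrt m
    have h2 : Real.sqrt m ≤ Real.sqrt s := Real.sqrt_le_sqrt hm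
    have h3 := Real.mul_self_sqrt hs0.le
    have h4 := Real.sqrt_nonneg s
    nlinarith
  by_cases hm : (m : ℝ) ≤ s
  · linarith [key1 hm]
  push Not at hm
  suffices ∑ i ∈ Finset.range m, ff s ((i : ℝ) + 1) ≤ 4 * s - s ^ 2 / m by
    have : 0 ≤ s ^ 2 / m := by positivity
    linarith
  clear key1
  revert hm
  induction m with
  | zero => intro hm; simp at hm; linarith
  | succ m ih =>
    intro hm
    push_cast at hm ⊢
    rw [Finset.sum_range_succ]
    have hf : ff s ((m : ℝ) + 1) = (s / (m + 1)) ^ 2 := by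
      unfold ff; rw [if_neg (by linarith)]
    rw [hf]
    by_cases h : s < m
    · have := ih h
      have hm0 : (0 : ℝ) < m := by linarith
      have e : (s / ((m : ℝ) + 1)) ^ 2 ≤ s ^ 2 / m - s ^ 2 / (m + 1) := by
        rw [div_sub_div _ _ (by positivity) (by positivity), div_pow,
          div_le_div_iff₀ (by positivity) (by positivity)]
        have : 0 ≤ s ^ 2 * (m + 1) := by positivity
        nlinarith
      linarith
    · push Not at h
      have h1 : ∑ i ∈ Finset.range m, ff s ((i : ℝ) + 1) ≤ 2 * s := by
        have : ∀ i ∈ Finset.range m, ff s ((i : ℝ) + 1) =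
            s ^ (1/2 : ℝ) * ((i : ℝ) + 1) ^ (-(1/2) : ℝ) := by
          intro i hi
          have hi' : (i : ℝ) + 1 ≤ m := by exact_mod_cast Finset.mem_range.1 hi
          unfold ff
          rw [if_pos (by linarith), Real.div_rpow (by positivity) hs0.le, Real.rpow_neg hs0.le]
          field_simp
        rw [Finset.sum_congr rfl this, ← Finset.mul_sum, ← Real.sqrt_eq_rpow]
        have h1 := sum_inv_sqrt m
        have h2 : Real.sqrt m ≤ Real.sqrt s := Real.sqrt_le_sqrt h
        have h3 := Real.mul_self_sqrt hs0.le
        have h4 := Real.sqrt_nonneg s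
        nlinarith
      have h2 : s / ((m : ℝ) + 1) ≤ 1 := by rw [div_le_one (by positivity)]; linarith
      have h3 : 0 ≤ s / ((m : ℝ) + 1) := by positivity
      have h4 : (s / ((m : ℝ) + 1)) ^ 2 ≤ 1 := by nlinarith
      have h5 : s ^ 2 / ((m : ℝ) + 1) ≤ s := by
        have : s ^ 2 / ((m : ℝ) + 1) = s * (s / (m + 1)) := by ring
        rw [this]; nlinarith
      linarith

/-- Two-sided weights. -/
noncomputable def ww (m i : ℕ) : ℝ := min ((i : ℝ) + 1) ((m : ℝ) - i)

theorem ww_ge_one {m i : ℕ} (h : i < m) : 1 ≤ ww m i := by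
  have : (i : ℝ) + 1 ≤ m := by exact_mod_cast h
  have h0 : (0 : ℝ) ≤ i := Nat.cast_nonneg _
  exact le_min (by linarith) (by linarith)

theorem ww_le {m i : ℕ} (h : i < m) : ww m i ≤ m := by
  have : (i : ℝ) + 1 ≤ m := by exact_mod_cast h
  exact (min_le_left _ _).trans this

theorem sum_ww (F : ℝ → ℝ) (hF : ∀ x, 0 < x → 0 ≤ F x) (m : ℕ) :
    ∑ i ∈ Finset.range m, F (ww m i) ≤ 2 * ∑ i ∈ Finset.range m, F ((i : ℝ) + 1) := by
  have h2 : ∑ i ∈ Finset.range m, F ((m : ℝ) - i) = ∑ i ∈ Finset.range m, F ((i : ℝ) + 1) := by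
    rw [← Finset.sum_range_reflect]
    apply Finset.sum_congr rfl
    intro i hi
    have hi := Finset.mem_range.1 hi
    congr 1
    rw [Nat.sub_sub, Nat.cast_sub (by omega)]
    push_cast
    ring
  calc ∑ i ∈ Finset.range m, F (ww m i)
      ≤ ∑ i ∈ Finset.range m, (F ((i : ℝ) + 1) + F ((m : ℝ) - i)) := by
        apply Finset.sum_le_sum
        intro i hi
        have : (i : ℝ) + 1 ≤ m := by exact_mod_cast Finset.mem_range.1 hi
        have h1 := hF ((i : ℝ) + 1) (by positivity)
        have h2 := hF ((m : ℝ) - i) (by linarith)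
        unfold ww
        rcases min_choice ((i : ℝ) + 1) ((m : ℝ) - i) with h | h <;> rw [h] <;> linarith
    _ = _ := by rw [Finset.sum_add_distrib, h2]; ring

/-- The scale factor. -/
noncomputable def th (d s m : ℝ) : ℝ := (min (m / s) (s / m)) ^ (d / 4)

theorem th_pos {d s m : ℝ} (hs : 0 < s) (hm : 0 < m) : 0 < th d s m := by
  unfold th
  apply Real.rpow_pos_of_pos
  exact lt_min (by positivity) (by positivity)

theorem cost_bound {d : ℝ} (hd : 0 < d) (hd4 : d ≤ 1/4) {s : ℝ} (hs : 1 ≤ s) {m : ℕ} (hm : 0 < m) :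
    ∃ μ > 0, s ^ 2 / (th d s m * (m : ℝ) ^ d) * μ +
      ∑ i ∈ Finset.range m, LL ((ww m i) ^ (1 - d) * μ) ≤ 200 * s * (th d s m) ^ (1/2 : ℝ) := by
  have hs0 : 0 < s := by linarith
  have hm0 : (0 : ℝ) < m := by exact_mod_cast hm
  set ζ : ℝ := m / s with hζ
  have hζ0 : 0 < ζ := by positivity
  have hmζ : (m : ℝ) = s * ζ := by rw [hζ]; field_simp
  have hinv : s / (m : ℝ) = ζ⁻¹ := by rw [hζ, inv_div]
  have hth0 := th_pos (d := d) hs0 hm0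
  have hT : ∀ ν : ℝ, s ^ 2 / (th d s m * (m : ℝ) ^ d) * (s ^ (-(1 - d)) * ν) =
      s * ((th d s m)⁻¹ * ζ ^ (-d) * ν) := by
    intro ν
    have h1 : (m : ℝ) ^ d = s ^ d * ζ ^ d := by rw [hmζ, Real.mul_rpow hs0.le hζ0.le]
    rw [h1, Real.rpow_neg hζ0.le, Real.rpow_neg hs0.le, Real.rpow_sub hs0, Real.rpow_one]
    have e1 : 0 < s ^ d := by positivity
    have e2 : 0 < ζ ^ d := by positivity
    field_simp
  have harg : ∀ (ν w : ℝ), 0 < w → w ^ (1 - d) * (s ^ (-(1 - d)) * ν) = (w / s) ^ (1 - d) * ν := by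
    intro ν w hw
    rw [Real.div_rpow hw.le hs0.le, Real.rpow_neg hs0.le]
    field_simp
  have hLL1 : ∀ ν u : ℝ, 0 < ν → 0 < u → u ≤ 1 →
      LL (u ^ (1 - d) * ν) ≤ 2 * (ν ^ (-(1/2) : ℝ) * u ^ (-(1/2) : ℝ)) := by
    intro ν u hν hu hu1
    refine (LL_le_one (by positivity)).trans ?_
    rw [Real.mul_rpow (by positivity) hν.le, ← Real.rpow_mul hu.le]
    have : u ^ ((1 - d) * (-(1/2))) ≤ u ^ (-(1/2) : ℝ) :=
      Real.rpow_le_rpow_of_exponent_ge hu hu1 (by linarith)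
    have h2 : 0 < ν ^ (-(1/2) : ℝ) := by positivity
    nlinarith
  rcases le_or_gt ζ 1 with h | h
  · -- coarse scales
    have hthv : th d s m = ζ ^ (d / 4) := by
      unfold th
      rw [← hζ, hinv, min_eq_left (h.trans ((one_le_inv₀ hζ0).2 h))]
    refine ⟨s ^ (-(1 - d)) * ζ ^ (1/2 : ℝ), by positivity, ?_⟩
    rw [hT]
    have e1 : (th d s m)⁻¹ * ζ ^ (-d) * ζ ^ (1/2 : ℝ) ≤ (th d s m) ^ (1/2 : ℝ) := by
      rw [hthv, ← Real.rpow_neg hζ0.le, ← Real.rpow_add hζ0, ← Real.rpow_add hζ0,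
        ← Real.rpow_mul hζ0.le]
      exact Real.rpow_le_rpow_of_exponent_ge hζ0 h (by linarith)
    have e2 : ∑ i ∈ Finset.range m, LL ((ww m i) ^ (1 - d) * (s ^ (-(1 - d)) * ζ ^ (1/2 : ℝ))) ≤
        8 * s * (th d s m) ^ (1/2 : ℝ) := by
      have hterm : ∀ i ∈ Finset.range m,
          LL ((ww m i) ^ (1 - d) * (s ^ (-(1 - d)) * ζ ^ (1/2 : ℝ))) ≤
          (2 * (ζ ^ (-(1/4) : ℝ) * s ^ (1/2 : ℝ))) * (ww m i) ^ (-(1/2) : ℝ) := by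
        intro i hi
        have hw := ww_ge_one (Finset.mem_range.1 hi)
        have hw2 := ww_le (Finset.mem_range.1 hi)
        have hwpos : 0 < ww m i := by linarith
        rw [harg _ _ hwpos]
        refine (hLL1 _ _ (by positivity) (by positivity) ?_).trans_eq ?_
        · rw [div_le_one hs0]
          have : (m : ℝ) ≤ s := by rw [hmζ]; nlinarith
          linarith
        · rw [← Real.rpow_mul hζ0.le, Real.div_rpow hwpos.le hs0.le, Real.rpow_neg hs0.le]
          norm_num
          ring
      refine (Finset.sum_le_sum hterm).trans ?_
      rw [← Finset.mul_sum]
      have h1 := sum_ww (fun x => x ^ (-(1/2) : ℝ)) (fun x hx => by positivity) m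
      have h2 := sum_inv_sqrt m
      have h3 : ∑ i ∈ Finset.range m, (ww m i) ^ (-(1/2) : ℝ) ≤ 4 * Real.sqrt m := by linarith
      have h4 : Real.sqrt m = s ^ (1/2 : ℝ) * ζ ^ (1/2 : ℝ) := by
        rw [Real.sqrt_eq_rpow, hmζ, Real.mul_rpow hs0.le hζ0.le]
      rw [h4] at h3
      have h5 : ζ ^ (-(1/4) : ℝ) * ζ ^ (1/2 : ℝ) ≤ (th d s m) ^ (1/2 : ℝ) := by
        rw [hthv, ← Real.rpow_add hζ0, ← Real.rpow_mul hζ0.le]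
        exact Real.rpow_le_rpow_of_exponent_ge hζ0 h (by linarith)
      have h6 : s ^ (1/2 : ℝ) * s ^ (1/2 : ℝ) = s := by
        rw [← Real.rpow_add hs0]; norm_num
      calc _ ≤ (2 * (ζ ^ (-(1/4) : ℝ) * s ^ (1/2 : ℝ))) * (4 * (s ^ (1/2 : ℝ) * ζ ^ (1/2 : ℝ))) :=
            mul_le_mul_of_nonneg_left h3 (by positivity)
        _ = 8 * (s ^ (1/2 : ℝ) * s ^ (1/2 : ℝ)) * (ζ ^ (-(1/4) : ℝ) * ζ ^ (1/2 : ℝ)) := by ring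
        _ ≤ _ := by rw [h6]; exact mul_le_mul_of_nonneg_left h5 (by positivity)
    have e3 := mul_le_mul_of_nonneg_left e1 hs0.le
    have e4 : 0 ≤ s * (th d s m) ^ (1/2 : ℝ) := by positivity
    linarith
  · -- fine scales
    have hthv : th d s m = ζ ^ (-(d / 4)) := by
      unfold th
      rw [← hζ, hinv, min_eq_right ((inv_le_one_of_one_le₀ h.le).trans h.le),
        Real.inv_rpow hζ0.le, Real.rpow_neg hζ0.le]
    refine ⟨s ^ (-(1 - d)) * ζ ^ (d / 4 : ℝ), by positivity, ?_⟩
    rw [hT]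
    set ν := ζ ^ (d / 4 : ℝ) with hν
    have hν0 : 0 < ν := by positivity
    have hν1 : 1 ≤ ν := Real.one_le_rpow h.le (by positivity)
    have hνth : ν ^ (-(1/2) : ℝ) = (th d s m) ^ (1/2 : ℝ) := by
      rw [hthv, hν, ← Real.rpow_mul hζ0.le, ← Real.rpow_mul hζ0.le]
      congr 1; ring
    have e1 : (th d s m)⁻¹ * ζ ^ (-d) * ν ≤ (th d s m) ^ (1/2 : ℝ) := by
      rw [hthv, hν, ← Real.rpow_neg hζ0.le, ← Real.rpow_add hζ0, ← Real.rpow_add hζ0,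
        ← Real.rpow_mul hζ0.le]
      exact Real.rpow_le_rpow_of_exponent_le h.le (by linarith)
    have e2 : ∑ i ∈ Finset.range m, LL ((ww m i) ^ (1 - d) * (s ^ (-(1 - d)) * ν)) ≤
        192 * s * (th d s m) ^ (1/2 : ℝ) := by
      have hterm : ∀ i ∈ Finset.range m,
          LL ((ww m i) ^ (1 - d) * (s ^ (-(1 - d)) * ν)) ≤
          (24 * ν ^ (-(1/2) : ℝ)) * ff s (ww m i) := by
        intro i hi
        have hw := ww_ge_one (Finset.mem_range.1 hi)
        have hwpos : 0 < ww m i := by linarith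
        rw [harg _ _ hwpos]
        have hνp : 0 < ν ^ (-(1/2) : ℝ) := by positivity
        unfold ff
        split_ifs with hws
        · refine (hLL1 _ _ hν0 (by positivity) ?_).trans ?_
          · rw [div_le_one hs0]; exact hws
          · have : 0 ≤ ν ^ (-(1/2) : ℝ) * (ww m i / s) ^ (-(1/2) : ℝ) := by positivity
            linarith
        · push Not at hws
          refine (LL_le_two (by positivity)).trans ?_
          have hu1 : 1 ≤ ww m i / s := by rw [one_le_div hs0]; exact hws.le
          rw [Real.mul_rpow (by positivity) hν0.le, ← Real.rpow_mul (by positivity)]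
          have f1 : (ww m i / s) ^ ((1 - d) * -4) ≤ (s / ww m i) ^ 2 := by
            have : (s / ww m i) ^ 2 = (ww m i / s) ^ (-2 : ℝ) := by
              rw [Real.rpow_neg (by positivity), ← inv_div (ww m i) s, inv_pow]
              norm_num
            rw [this]
            exact Real.rpow_le_rpow_of_exponent_le hu1 (by linarith)
          have f2 : ν ^ (-4 : ℝ) ≤ ν ^ (-(1/2) : ℝ) :=
            Real.rpow_le_rpow_of_exponent_le hν1 (by norm_num)
          have := mul_le_mul f1 f2 (by positivity) (by positivity)
          linarith
      refine (Finset.sum_le_sum hterm).trans ?_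
      rw [← Finset.mul_sum]
      have h1 := sum_ww (ff s) (fun x hx => ff_nonneg hs0 hx) m
      have h2 := sum_ff hs m
      rw [← hνth]
      have hνp : 0 < ν ^ (-(1/2) : ℝ) := by positivity
      calc _ ≤ (24 * ν ^ (-(1/2) : ℝ)) * (8 * s) :=
            mul_le_mul_of_nonneg_left (by linarith) (by positivity)
        _ = _ := by ring
    have e3 := mul_le_mul_of_nonneg_left e1 hs0.le
    have e4 : 0 ≤ s * (th d s m) ^ (1/2 : ℝ) := by positivity
    linarith

theorem geom_sum_bound {κ : ℝ} (hκ : 0 < κ) : ∃ C > 0, ∀ s : ℝ, 1 ≤ s → ∀ K : ℕ,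
    ∑ k ∈ Finset.range K, (min ((2 : ℝ) ^ k / s) (s / 2 ^ k)) ^ κ ≤ C := by
  set q : ℝ := (2 : ℝ) ^ κ with hq
  have hq1 : 1 < q := Real.one_lt_rpow (by norm_num) hκ
  set c : ℝ := 1 / (q - 1) with hc
  have hcpos : 0 < c := by apply one_div_pos.2; linarith
  have hcq : c * q = c + 1 := by
    rw [hc]; have : q - 1 ≠ 0 := by linarith
    field_simp; ring
  set c2 : ℝ := q / (q - 1) with hc2
  have hc2pos : 0 < c2 := div_pos (by linarith) (by linarith)
  refine ⟨c * q + c2, by positivity, ?_⟩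
  intro s hs K
  have hs0 : 0 < s := by linarith
  set u : ℕ → ℝ := fun k => ((2 : ℝ) ^ k / s) ^ κ with hu
  have hupos : ∀ k, 0 < u k := fun k => by simp only [hu]; positivity
  have husucc : ∀ k, u (k + 1) = q * u k := by
    intro k
    simp only [hu, hq]
    rw [← Real.mul_rpow (by norm_num) (by positivity)]
    congr 1; rw [pow_succ]; ring
  have hmin : ∀ k, (min ((2 : ℝ) ^ k / s) (s / 2 ^ k)) ^ κ = min (u k) (u k)⁻¹ := by
    intro k
    have e : s / (2 : ℝ) ^ k = ((2 : ℝ) ^ k / s)⁻¹ := by rw [inv_div]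
    have hp : 0 < (2 : ℝ) ^ k / s := by positivity
    simp only [hu]
    rw [← Real.inv_rpow hp.le, ← e]
    have e2 : 0 < s / (2 : ℝ) ^ k := by positivity
    rcases le_total ((2 : ℝ) ^ k / s) (s / 2 ^ k) with h | h
    · rw [min_eq_left h, min_eq_left (Real.rpow_le_rpow hp.le h hκ.le)]
    · rw [min_eq_right h, min_eq_right (Real.rpow_le_rpow e2.le h hκ.le)]
  simp_rw [hmin]
  have main : ∀ K, (u K ≤ q → ∑ k ∈ Finset.range K, min (u k) (u k)⁻¹ ≤ c * u K) ∧
      (1 < u K → ∑ k ∈ Finset.range K, min (u k) (u k)⁻¹ ≤ c * q + c2 - c2 / u K) := by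
    intro K
    induction K with
    | zero =>
      have h0 : u 0 ≤ 1 := by
        simp only [hu, pow_zero]
        apply Real.rpow_le_one (by positivity) _ hκ.le
        rw [div_le_one hs0]; exact hs
      constructor
      · intro _; simp; exact mul_nonneg hcpos.le (hupos 0).le
      · intro h; linarith
    | succ K ih =>
      have hK := hupos K
      have A : u K ≤ 1 → ∑ k ∈ Finset.range (K + 1), min (u k) (u k)⁻¹ ≤ c * u (K + 1) := by
        intro h
        rw [Finset.sum_range_succ, husucc]
        have := ih.1 (by linarith)
        have h2 := min_le_left (u K) (u K)⁻¹
        have : c * (q * u K) = (c * q) * u K := by ring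
        rw [this, hcq]; linarith
      constructor
      · intro h
        rw [husucc] at h
        exact A (by nlinarith)
      · intro h
        by_cases h1 : u K ≤ 1
        · have := A h1
          rw [husucc] at this h ⊢
          have h3 : c2 / (q * u K) ≤ c2 := by
            rw [div_le_iff₀ (by positivity)]; nlinarith
          have : c * (q * u K) ≤ c * q := by nlinarith [mul_pos hcpos (by linarith : 0 < q)]
          linarith
        · push Not at h1
          have := ih.2 h1
          rw [Finset.sum_range_succ, husucc]
          have h2 := min_le_right (u K) (u K)⁻¹
          have h3 : c2 / u K - c2 / (q * u K) = (u K)⁻¹ := by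
            rw [hc2]; have : q - 1 ≠ 0 := by linarith
            have : q ≠ 0 := by linarith
            field_simp
          linarith
  rcases le_or_gt (u K) 1 with h | h
  · have := (main K).1 (by linarith)
    nlinarith
  · have := (main K).2 h
    have : 0 ≤ c2 / u K := by have := hupos K; positivity
    linarith

/-- Midpoint deviation on the `i`-th interval of the grid of mesh `1/m`. -/
noncomputable def DD (m i : ℕ) (ψ : ℝ → ℝ) : ℝ :=
  ψ ((2 * (i : ℝ) + 1) / (2 * m)) - (ψ ((i : ℝ) / m) + ψ (((i : ℝ) + 1) / m)) / 2

/-- Bounded concave functions on the unit interval. -/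
def CC : Set (ℝ → ℝ) :=
  {ψ | ConcaveOn ℝ (Set.Icc 0 1) ψ ∧ ∀ x ∈ Set.Icc (0 : ℝ) 1, 0 ≤ ψ x ∧ ψ x ≤ 1}

theorem parab_sum (a : ℕ → ℝ) (Q : ℝ) (n : ℕ) :
    ∑ j ∈ Finset.range n, ((j : ℝ) + 1) * (Q - (j + 1)) * (2 * a (j + 1) - a j - a (j + 2)) =
      2 * ∑ j ∈ Finset.range n, a (j + 1) - (Q - 1) * a 0 + ((n : ℝ) + 1) * (Q - (n + 1)) * a n
        - n * (Q - n) * a (n + 1) := by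
  induction n with
  | zero => simp
  | succ n ih =>
    rw [Finset.sum_range_succ, Finset.sum_range_succ, ih]
    push_cast
    ring

theorem DD_weighted {ψ : ℝ → ℝ} (hψ : ψ ∈ CC) {m : ℕ} (hm : 0 < m) :
    (∀ i < m, 0 ≤ DD m i ψ) ∧ ∑ i ∈ Finset.range m, ww m i * DD m i ψ ≤ 2 := by
  obtain ⟨hc, hb⟩ := hψ
  have hm0 : (0 : ℝ) < m := by exact_mod_cast hm
  set a : ℕ → ℝ := fun j => ψ ((j : ℝ) / (2 * m)) with ha
  have hmem : ∀ j : ℕ, j ≤ 2 * m → ((j : ℝ) / (2 * m)) ∈ Set.Icc (0 : ℝ) 1 := by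
    intro j hj
    have : (j : ℝ) ≤ 2 * m := by exact_mod_cast hj
    exact ⟨by positivity, by rw [div_le_one (by positivity)]; exact this⟩
  have hDpos : ∀ j : ℕ, j + 2 ≤ 2 * m → 0 ≤ 2 * a (j + 1) - a j - a (j + 2) := by
    intro j hj
    have := hc.2 (hmem j (by omega)) (hmem (j + 2) hj) (by norm_num : (0 : ℝ) ≤ 1/2)
      (by norm_num : (0 : ℝ) ≤ 1/2) (by norm_num)
    simp only [smul_eq_mul] at this
    have e : (1 / 2 : ℝ) * ((j : ℝ) / (2 * m)) + 1 / 2 * (((j + 2 : ℕ) : ℝ) / (2 * m)) =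
        ((j + 1 : ℕ) : ℝ) / (2 * m) := by push_cast; field_simp; ring
    rw [e] at this
    simp only [ha]
    linarith
  have hDD : ∀ i, DD m i ψ = (2 * a (2 * i + 1) - a (2 * i) - a (2 * i + 2)) / 2 := by
    intro i
    unfold DD
    simp only [ha]
    push_cast
    have e1 : (2 * (i : ℝ)) / (2 * m) = i / m := by field_simp
    have e2 : (2 * (i : ℝ) + 2) / (2 * m) = (i + 1) / m := by field_simp
    rw [e1, e2]
    ring
  refine ⟨fun i hi => ?_, ?_⟩
  · rw [hDD]
    have := hDpos (2 * i) (by omega)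
    linarith
  set F : ℕ → ℝ := fun j => ((j : ℝ) + 1) * ((2 * m : ℝ) - (j + 1)) *
    (2 * a (j + 1) - a j - a (j + 2)) with hF
  have hFpos : ∀ j ∈ Finset.range (2 * m - 1), 0 ≤ F j := by
    intro j hj
    have hj := Finset.mem_range.1 hj
    have h1 := hDpos j (by omega)
    have h2 : (j : ℝ) + 1 ≤ 2 * m := by
      have : j + 1 ≤ 2 * m := by omega
      exact_mod_cast this
    simp only [hF]
    have h3 : (0 : ℝ) ≤ 2 * m - (j + 1) := by linarith
    positivity
  have step1 : ∑ i ∈ Finset.range m, F (2 * i) ≤ ∑ j ∈ Finset.range (2 * m - 1), F j := by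
    rw [← Finset.sum_image (f := F) (g := fun i => 2 * i) (by intro x _ y _ h; simpa using h)]
    apply Finset.sum_le_sum_of_subset_of_nonneg
    · intro j hj
      simp only [Finset.mem_image, Finset.mem_range] at hj ⊢
      omega
    · intro j hj _; exact hFpos j hj
  have step2 : ∑ j ∈ Finset.range (2 * m - 1), F j ≤ 2 * (2 * m) := by
    simp only [hF]
    rw [parab_sum a (2 * m) (2 * m - 1)]
    have hcast : ((2 * m - 1 : ℕ) : ℝ) = 2 * m - 1 := by
      rw [Nat.cast_sub (by omega)]; push_cast; ring
    rw [hcast]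
    have hsum : ∑ j ∈ Finset.range (2 * m - 1), a (j + 1) ≤ (2 * m - 1 : ℕ) * 1 := by
      have : ∑ j ∈ Finset.range (2 * m - 1), a (j + 1) ≤ ∑ j ∈ Finset.range (2 * m - 1), (1 : ℝ) := by
        apply Finset.sum_le_sum
        intro j hj
        have hj := Finset.mem_range.1 hj
        exact (hb _ (hmem (j + 1) (by omega))).2
      simpa using this
    rw [hcast] at hsum
    have h0 : 0 ≤ a 0 := (hb _ (hmem 0 (by omega))).1
    have h2 : 0 ≤ a (2 * m - 1 + 1) := (hb _ (hmem (2 * m - 1 + 1) (by omega))).1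
    have hm1 : (1 : ℝ) ≤ m := by exact_mod_cast hm
    have e1 : 0 ≤ (2 * (m : ℝ) - 1) * a 0 := mul_nonneg (by linarith) h0
    have e2 : 0 ≤ (2 * (m : ℝ) - 1) * a (2 * m - 1 + 1) := mul_nonneg (by linarith) h2
    nlinarith
  have step3 : ∀ i ∈ Finset.range m, ww m i * DD m i ψ ≤ F (2 * i) / (2 * m) := by
    intro i hi
    have hi := Finset.mem_range.1 hi
    have h1 := hDpos (2 * i) (by omega)
    rw [hDD]
    simp only [hF]
    have hi' : (i : ℝ) + 1 ≤ m := by exact_mod_cast hi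
    have hi0 : (0 : ℝ) ≤ i := Nat.cast_nonneg _
    have hw : ww m i * m ≤ (2 * i + 1) * (2 * m - (2 * i + 1)) := by
      have w1 : ww m i ≤ i + 1 := min_le_left _ _
      have w2 : ww m i ≤ m - i := min_le_right _ _
      rcases le_total (2 * (i : ℝ) + 1) m with h | h
      · nlinarith
      · nlinarith
    push_cast
    rw [le_div_iff₀ (by positivity)]
    have := mul_le_mul_of_nonneg_right hw h1
    linarith
  calc _ ≤ ∑ i ∈ Finset.range m, F (2 * i) / (2 * m) := Finset.sum_le_sum step3
    _ = (∑ i ∈ Finset.range m, F (2 * i)) / (2 * m) := by rw [Finset.sum_div]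
    _ ≤ 2 := by rw [div_le_iff₀ (by positivity)]; linarith

/-- Piecewise linear interpolation. -/
noncomputable def PP (m : ℕ) (ψ : ℝ → ℝ) (x : ℝ) : ℝ :=
  ψ ((⌊(m : ℝ) * x⌋₊ : ℝ) / m) + (m * x - ⌊(m : ℝ) * x⌋₊) *
    (ψ (((⌊(m : ℝ) * x⌋₊ : ℝ) + 1) / m) - ψ ((⌊(m : ℝ) * x⌋₊ : ℝ) / m))

theorem PP_step {m : ℕ} (hm : 0 < m) (ψ : ℝ → ℝ) {x : ℝ} (hx : 0 ≤ x) :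
    |PP (2 * m) ψ x - PP m ψ x| ≤ |DD m ⌊(m : ℝ) * x⌋₊ ψ| := by
  have hm0 : (0 : ℝ) < m := by exact_mod_cast hm
  set i := ⌊(m : ℝ) * x⌋₊ with hi
  have h1 : (i : ℝ) ≤ m * x := Nat.floor_le (by positivity)
  have h2 : m * x < i + 1 := Nat.lt_floor_add_one _
  set t := (m : ℝ) * x - i with ht
  by_cases h : t < 1 / 2
  · have hfl : ⌊((2 * m : ℕ) : ℝ) * x⌋₊ = 2 * i := by
      rw [Nat.floor_eq_iff (by positivity)]
      push_cast
      constructor <;> linarith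
    unfold PP
    rw [hfl, ← hi, ← ht]
    unfold DD
    push_cast
    have e1 : (2 * (i : ℝ)) / (2 * m) = i / m := by field_simp
    have e3 : 2 * (m : ℝ) * x - 2 * i = 2 * t := by rw [ht]; ring
    rw [e1, e3]
    have : ψ ((i : ℝ) / m) + 2 * t * (ψ ((2 * (i : ℝ) + 1) / (2 * m)) - ψ (i / m)) -
        (ψ (i / m) + t * (ψ ((i + 1) / m) - ψ (i / m))) = (2 * t) *
        (ψ ((2 * (i : ℝ) + 1) / (2 * m)) - (ψ ((i : ℝ) / m) + ψ (((i : ℝ) + 1) / m)) / 2) := by ring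
    rw [this, abs_mul]
    have h3 : |2 * t| ≤ 1 := by rw [abs_le]; constructor <;> linarith
    exact mul_le_of_le_one_left (abs_nonneg _) h3
  · push Not at h
    have hfl : ⌊((2 * m : ℕ) : ℝ) * x⌋₊ = 2 * i + 1 := by
      rw [Nat.floor_eq_iff (by positivity)]
      push_cast
      constructor <;> linarith
    unfold PP
    rw [hfl, ← hi, ← ht]
    unfold DD
    push_cast
    have e2 : (2 * (i : ℝ) + 1 + 1) / (2 * m) = (i + 1) / m := by field_simp; ring
    have e3 : 2 * (m : ℝ) * x - (2 * i + 1) = 2 * t - 1 := by rw [ht]; ring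
    rw [e2, e3]
    have : ψ ((2 * (i : ℝ) + 1) / (2 * m)) + (2 * t - 1) *
        (ψ ((i + 1) / m) - ψ ((2 * (i : ℝ) + 1) / (2 * m))) -
        (ψ (i / m) + t * (ψ ((i + 1) / m) - ψ (i / m))) = (2 - 2 * t) *
        (ψ ((2 * (i : ℝ) + 1) / (2 * m)) - (ψ ((i : ℝ) / m) + ψ (((i : ℝ) + 1) / m)) / 2) := by ring
    rw [this, abs_mul]
    have h3 : |2 - 2 * t| ≤ 1 := by rw [abs_le]; constructor <;> linarith
    exact mul_le_of_le_one_left (abs_nonneg _) h3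

theorem PP_tendsto (ψ : ℝ → ℝ) {x : ℝ} (hx : 0 ≤ x) (hc : ContinuousAt ψ x) :
    Tendsto (fun k : ℕ => PP (2 ^ k) ψ x) atTop (nhds (ψ x)) := by
  rw [Metric.tendsto_atTop]
  intro ε hε
  obtain ⟨δ, hδ, hcont⟩ := Metric.continuousAt_iff.1 hc (ε / 2) (by positivity)
  obtain ⟨K, hK⟩ := exists_pow_lt_of_lt_one hδ (by norm_num : (1/2 : ℝ) < 1)
  refine ⟨K, fun k hk => ?_⟩
  have hkδ : (1 / 2 : ℝ) ^ k < δ :=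
    lt_of_le_of_lt (pow_le_pow_of_le_one (by norm_num) (by norm_num) hk) hK
  set m : ℕ := 2 ^ k with hm
  have hm0 : (0 : ℝ) < m := by rw [hm]; positivity
  have hinv : 1 / (m : ℝ) < δ := by
    rw [hm]; push_cast; rwa [one_div_pow] at hkδ
  unfold PP
  set i := ⌊(m : ℝ) * x⌋₊ with hi
  have h1 : (i : ℝ) ≤ m * x := Nat.floor_le (by positivity)
  have h2 : m * x < i + 1 := Nat.lt_floor_add_one _
  set t := (m : ℝ) * x - i with ht
  have d1 : dist ((i : ℝ) / m) x < δ := by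
    have : (i : ℝ) / m - x = - (t / m) := by rw [ht]; field_simp; ring
    rw [Real.dist_eq, this, abs_neg, abs_of_nonneg (div_nonneg (by linarith) hm0.le)]
    refine lt_of_le_of_lt ?_ hinv
    exact div_le_div_of_nonneg_right (by linarith) hm0.le
  have d2 : dist (((i : ℝ) + 1) / m) x < δ := by
    have : ((i : ℝ) + 1) / m - x = (1 - t) / m := by rw [ht]; field_simp; ring
    rw [Real.dist_eq, this, abs_of_nonneg (div_nonneg (by linarith) hm0.le)]
    refine lt_of_le_of_lt ?_ hinv
    exact div_le_div_of_nonneg_right (by linarith) hm0.le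
  have c1 := hcont d1
  have c2 := hcont d2
  rw [Real.dist_eq] at c1 c2 ⊢
  have : ψ ((i : ℝ) / m) + t * (ψ (((i : ℝ) + 1) / m) - ψ ((i : ℝ) / m)) - ψ x =
    (1 - t) * (ψ ((i : ℝ) / m) - ψ x) + t * (ψ (((i : ℝ) + 1) / m) - ψ x) := by ring
  rw [this]
  refine (abs_add_le _ _).trans_lt ?_
  rw [abs_mul, abs_mul, abs_of_nonneg (by linarith : 0 ≤ 1 - t), abs_of_nonneg (by linarith : 0 ≤ t)]
  nlinarith [abs_nonneg (ψ ((i : ℝ) / m) - ψ x), abs_nonneg (ψ (((i : ℝ) + 1) / m) - ψ x)]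

theorem schauder_bound {ψ : ℝ → ℝ} {x : ℝ} (hx : x ∈ Set.Ioo (0 : ℝ) 1) (hc : ContinuousAt ψ x)
    {e0 E : ℝ} (h0 : |ψ 0| ≤ e0) (h1 : |ψ 1| ≤ e0) (e : ℕ → ℝ)
    (he : ∀ k, |DD (2 ^ k) ⌊((2 ^ k : ℕ) : ℝ) * x⌋₊ ψ| ≤ e k)
    (hE : ∀ K, ∑ k ∈ Finset.range K, e k ≤ E) : |ψ x| ≤ e0 + E := by
  have hP : ∀ K, |PP (2 ^ K) ψ x| ≤ e0 + ∑ k ∈ Finset.range K, e k := by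
    intro K
    induction K with
    | zero =>
      have hfl : ⌊x⌋₊ = 0 := Nat.floor_eq_zero.2 hx.2
      unfold PP
      simp only [pow_zero, Nat.cast_one, one_mul, hfl, Nat.cast_zero, sub_zero, zero_add,
        div_one, Finset.range_zero, Finset.sum_empty, add_zero]
      have : ψ 0 + x * (ψ 1 - ψ 0) = (1 - x) * ψ 0 + x * ψ 1 := by ring
      rw [this]
      refine (abs_add_le _ _).trans ?_
      rw [abs_mul, abs_mul, abs_of_nonneg (by linarith [hx.2] : 0 ≤ 1 - x), abs_of_nonneg hx.1.le]
      nlinarith [hx.1, hx.2]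
    | succ K ih =>
      rw [Finset.sum_range_succ]
      have h2 := PP_step (m := 2 ^ K) (by positivity) ψ hx.1.le
      have h3 := he K
      rw [pow_succ, mul_comm]
      have h4 := abs_sub_abs_le_abs_sub (PP (2 * 2 ^ K) ψ x) (PP (2 ^ K) ψ x)
      linarith
  have hlim := (PP_tendsto ψ hx.1.le hc).abs
  refine le_of_tendsto' hlim fun K => (hP K).trans ?_
  linarith [hE K]

theorem floor_eq_abs {a b : ℝ} (ha : 0 ≤ a) (hb : 0 ≤ b) (h : ⌊a⌋₊ = ⌊b⌋₊) : |a - b| ≤ 1 := by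
  have h1 := Nat.floor_le ha
  have h2 := Nat.floor_le hb
  have h3 := Nat.lt_floor_add_one a
  have h4 := Nat.lt_floor_add_one b
  rw [h] at h1 h3
  rw [abs_le]; constructor <;> linarith

theorem Col.floor {X : Type*} {F : Set X} (q : X → ℝ) {A L : ℝ} (hq : ∀ a ∈ F, 0 ≤ q a ∧ q a ≤ A)
    (hA : A + 1 ≤ Real.exp L) : Col F (fun a b => ⌊q a⌋₊ = ⌊q b⌋₊) L :=
  ⟨fun a => ⌊q a⌋₊, fun a ha => by
    have := Nat.floor_le (hq a ha).1
    have := (hq a ha).2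
    linarith, fun a _ b _ h => h⟩

/-- Quantisation unit. -/
noncomputable def unit' (d s η : ℝ) (m i : ℕ) : ℝ := η * th d s m * (ww m i / m) ^ (-d)

theorem unit'_pos {d s η : ℝ} (hs : 0 < s) (hη : 0 < η) {m i : ℕ} (hi : i < m) :
    0 < unit' d s η m i := by
  have hm : (0 : ℝ) < m := by exact_mod_cast (by omega : 0 < m)
  have := ww_ge_one hi
  have := th_pos (d := d) hs hm
  unfold unit'
  have : 0 < ww m i / m := by positivity
  positivity

theorem code_weighted {d s η : ℝ} (hd : 0 < d) (hs : 0 < s) (hη : 0 < η) (hsη : s ^ 2 = 2 / η)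
    {m : ℕ} (hm : 0 < m) {ψ : ℝ → ℝ} (hψ : ψ ∈ CC) :
    ∑ i ∈ Finset.range m, (ww m i) ^ (1 - d) * (⌊DD m i ψ / unit' d s η m i⌋₊ : ℝ) ≤
      s ^ 2 / (th d s m * (m : ℝ) ^ d) := by
  obtain ⟨h1, h2⟩ := DD_weighted hψ hm
  have hm0 : (0 : ℝ) < m := by exact_mod_cast hm
  have hth := th_pos (d := d) hs hm0
  have hmd : 0 < (m : ℝ) ^ d := by positivity
  have hterm : ∀ i ∈ Finset.range m,
      (ww m i) ^ (1 - d) * (⌊DD m i ψ / unit' d s η m i⌋₊ : ℝ) ≤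
      (ww m i * DD m i ψ) / (η * (th d s m * (m : ℝ) ^ d)) := by
    intro i hi
    have hi := Finset.mem_range.1 hi
    have hw := ww_ge_one hi
    have hw0 : 0 < ww m i := by linarith
    have hu := unit'_pos (d := d) hs hη hi
    have hD := h1 i hi
    have hf : (⌊DD m i ψ / unit' d s η m i⌋₊ : ℝ) ≤ DD m i ψ / unit' d s η m i :=
      Nat.floor_le (by positivity)
    refine (mul_le_mul_of_nonneg_left hf (by positivity)).trans_eq ?_
    unfold unit'
    rw [Real.rpow_sub hw0, Real.rpow_one, Real.rpow_neg (by positivity),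
      Real.div_rpow hw0.le hm0.le]
    have : 0 < ww m i ^ d := by positivity
    field_simp
  refine (Finset.sum_le_sum hterm).trans ?_
  rw [← Finset.sum_div, hsη]
  have e : (2 / η) / (th d s m * (m : ℝ) ^ d) = 2 / (η * (th d s m * (m : ℝ) ^ d)) := by
    field_simp
  rw [e]
  exact div_le_div_of_nonneg_right h2 (by positivity)

theorem level_col {d s η : ℝ} (hd : 0 < d) (hd4 : d ≤ 1/4) (hs : 1 ≤ s) (hη : 0 < η)
    (hsη : s ^ 2 = 2 / η) {m : ℕ} (hm : 0 < m) :
    Col CC (fun ψ ψ' => ∀ i < m, ⌊DD m i ψ / unit' d s η m i⌋₊ = ⌊DD m i ψ' / unit' d s η m i⌋₊)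
      (200 * s * (th d s m) ^ (1/2 : ℝ)) := by
  obtain ⟨μ, hμ, hcost⟩ := cost_bound hd hd4 hs hm
  have hs0 : 0 < s := by linarith
  set T := s ^ 2 / (th d s m * (m : ℝ) ^ d) with hT
  obtain ⟨hfin, hcard⟩ := kraft_count (m := m) (fun i => (ww m i) ^ (1 - d) * μ)
    (fun i => by
      have := ww_ge_one i.2
      have : 0 < ww m i := by linarith
      positivity) (T * μ)
  have := Col.of_code (F := CC)
    (code := fun ψ => fun i : Fin m => ⌊DD m i ψ / unit' d s η m i⌋₊) _ hfin
    (L := 200 * s * (th d s m) ^ (1/2 : ℝ)) (hcard.trans (Real.exp_le_exp.2 ?_)) ?_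
  · refine this.mono le_rfl ?_
    intro a _ b _ h i hi
    exact congrFun h ⟨i, hi⟩
  · refine le_trans (le_of_eq ?_) hcost
    congr 1
    rw [Finset.sum_range]
  · intro ψ hψ
    have h1 := code_weighted hd hs0 hη hsη hm hψ
    rw [Finset.sum_range] at h1
    show ∑ i : Fin m, (ww m i) ^ (1 - d) * μ * ((⌊DD m i ψ / unit' d s η m i⌋₊ : ℕ) : ℝ) ≤ T * μ
    have h2 := mul_le_mul_of_nonneg_right h1 hμ.le
    rw [Finset.sum_mul] at h2
    refine le_trans (le_of_eq ?_) h2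
    exact Finset.sum_congr rfl fun i _ => by ring

theorem level_trivial {d s η : ℝ} (hd : 0 < d) (hd4 : d ≤ 1/4) (hs : 1 ≤ s) (hη : 0 < η)
    (hsη : s ^ 2 = 2 / η) :
    ∃ K : ℕ, ∀ k, K ≤ k → ∀ ψ ∈ CC, ∀ i < 2 ^ k,
      ⌊DD (2 ^ k) i ψ / unit' d s η (2 ^ k) i⌋₊ = 0 := by
  have hs0 : 0 < s := by linarith
  have hq : 1 < (2 : ℝ) ^ (3 * d / 4) := Real.one_lt_rpow (by norm_num) (by positivity)
  have t1 := (tendsto_pow_atTop_atTop_of_one_lt hq).eventually_gt_atTop (s ^ 2)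
  have t2 := (tendsto_pow_atTop_atTop_of_one_lt (by norm_num : (1 : ℝ) < 2)).eventually_ge_atTop s
  obtain ⟨K, hK⟩ := eventually_atTop.1 (t1.and t2)
  refine ⟨K, fun k hk ψ hψ i hi => ?_⟩
  obtain ⟨h1, h2⟩ := hK k hk
  have hm : 0 < 2 ^ k := by positivity
  have h3 := code_weighted hd hs0 hη hsη hm hψ
  have hm0 : (0 : ℝ) < ((2 ^ k : ℕ) : ℝ) := by positivity
  have hw := ww_ge_one hi
  have h4 : (ww (2 ^ k) i) ^ (1 - d) * (⌊DD (2 ^ k) i ψ / unit' d s η (2 ^ k) i⌋₊ : ℝ) ≤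
      s ^ 2 / (th d s (2 ^ k : ℕ) * ((2 ^ k : ℕ) : ℝ) ^ d) := by
    refine le_trans ?_ h3
    apply Finset.single_le_sum (f := fun i => (ww (2 ^ k) i) ^ (1 - d) *
      (⌊DD (2 ^ k) i ψ / unit' d s η (2 ^ k) i⌋₊ : ℝ)) ?_ (Finset.mem_range.2 hi)
    intro j hj
    have := ww_ge_one (Finset.mem_range.1 hj)
    have : 0 < ww (2 ^ k) j := by linarith
    positivity
  have h5 : s ^ 2 < th d s (2 ^ k : ℕ) * ((2 ^ k : ℕ) : ℝ) ^ d := by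
    push_cast
    have hp : (0 : ℝ) < 2 ^ k := by positivity
    have hmin : min ((2 : ℝ) ^ k / s) (s / 2 ^ k) = s / 2 ^ k := by
      apply min_eq_right
      rw [div_le_div_iff₀ hp hs0]; nlinarith
    unfold th
    rw [hmin, Real.div_rpow hs0.le hp.le]
    have e1 : ((2 : ℝ) ^ k) ^ d = ((2 : ℝ) ^ k) ^ (d / 4) * ((2 : ℝ) ^ k) ^ (3 * d / 4) := by
      rw [← Real.rpow_add hp]; congr 1; ring
    have e2 : ((2 : ℝ) ^ (3 * d / 4)) ^ k = ((2 : ℝ) ^ k) ^ (3 * d / 4) := by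
      rw [← Real.rpow_natCast, ← Real.rpow_natCast, ← Real.rpow_mul (by norm_num),
        ← Real.rpow_mul (by norm_num), mul_comm]
    rw [e2] at h1
    have e3 : 0 < ((2 : ℝ) ^ k) ^ (d / 4) := by positivity
    have e4 : s ^ (d / 4) / ((2 : ℝ) ^ k) ^ (d / 4) * ((2 : ℝ) ^ k) ^ d =
        s ^ (d / 4) * ((2 : ℝ) ^ k) ^ (3 * d / 4) := by
      rw [e1]; field_simp
    rw [e4]
    have e5 : 1 ≤ s ^ (d / 4) := Real.one_le_rpow hs (by positivity)
    have e6 : 0 < ((2 : ℝ) ^ k) ^ (3 * d / 4) := by positivity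
    nlinarith
  have h6 : s ^ 2 / (th d s (2 ^ k : ℕ) * ((2 ^ k : ℕ) : ℝ) ^ d) < 1 := by
    rw [div_lt_one (lt_trans (by positivity) h5)]; exact h5
  have h7 : 1 ≤ (ww (2 ^ k) i) ^ (1 - d) := Real.one_le_rpow hw (by linarith)
  by_contra hne
  have h8 : (1 : ℝ) ≤ (⌊DD (2 ^ k) i ψ / unit' d s η (2 ^ k) i⌋₊ : ℝ) := by
    exact_mod_cast Nat.one_le_iff_ne_zero.2 hne
  nlinarith

theorem one_add_le_exp {η : ℝ} (hη : 0 < η) : 1 / η + 1 ≤ Real.exp (2 * η ^ (-(1:ℝ)/2)) := by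
  set v := η ^ (-(1:ℝ)/2) with hv
  have hv0 : 0 < v := by positivity
  have hv2 : v ^ 2 = 1 / η := by
    rw [hv, ← Real.rpow_natCast, ← Real.rpow_mul hη.le]
    norm_num
    rw [Real.rpow_neg_one]
  rw [← hv2]
  have h1 := Real.add_one_le_exp v
  have : Real.exp (2 * v) = Real.exp v ^ 2 := by rw [← Real.exp_nat_mul]; norm_num
  rw [this]
  nlinarith

/-- Bracketing of bounded concave functions on the unit interval. -/
theorem lemA {d : ℝ} (hd : 0 < d) (hd4 : d ≤ 1/4) : ∃ C > 0, ∀ η > 0,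
    Col CC (fun ψ ψ' => ∀ x ∈ Set.Ioo (0 : ℝ) 1, |ψ x - ψ' x| ≤ C * η * (min x (1 - x)) ^ (-d))
      (C * η ^ (-(1:ℝ)/2)) := by
  obtain ⟨C1, hC1, hg1⟩ := geom_sum_bound (κ := d / 4) (by positivity)
  obtain ⟨C2, hC2, hg2⟩ := geom_sum_bound (κ := d / 4 * (1/2)) (by positivity)
  refine ⟨1 + C1 + (4 + 400 * C2), by positivity, ?_⟩
  intro η hη
  have hdist1 : ∀ x ∈ Set.Ioo (0 : ℝ) 1, 1 ≤ (min x (1 - x)) ^ (-d) := by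
    intro x hx
    apply Real.one_le_rpow_of_pos_of_le_one_of_nonpos
    · exact lt_min hx.1 (by linarith [hx.2])
    · exact (min_le_left _ _).trans hx.2.le
    · linarith
  rcases le_or_gt 1 η with h | h
  · refine Col.trivial (by positivity) ?_
    intro a ha b hb x hx
    have h1 := ha.2 x ⟨hx.1.le, hx.2.le⟩
    have h2 := hb.2 x ⟨hx.1.le, hx.2.le⟩
    have h3 : |a x - b x| ≤ 1 := by rw [abs_le]; constructor <;> linarith
    have h4 := hdist1 x hx
    have h5 : 1 ≤ (1 + C1 + (4 + 400 * C2)) * η := by nlinarith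
    nlinarith
  · set s : ℝ := Real.sqrt (2 / η) with hs
    have hs2 : s ^ 2 = 2 / η := Real.sq_sqrt (by positivity)
    have hs1 : 1 ≤ s := by
      rw [hs, Real.one_le_sqrt, one_le_div hη]; linarith
    have hs0 : 0 < s := by linarith
    have hsle : s ≤ 2 * η ^ (-(1:ℝ)/2) := by
      have hv2 : (η ^ (-(1:ℝ)/2)) ^ 2 = 1 / η := by
        rw [← Real.rpow_natCast, ← Real.rpow_mul hη.le]
        norm_num
        rw [Real.rpow_neg_one]
      have hv0 : 0 < η ^ (-(1:ℝ)/2) := by positivity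
      have : s ^ 2 ≤ (2 * η ^ (-(1:ℝ)/2)) ^ 2 := by
        rw [mul_pow, hv2, hs2]
        have : 0 < 1 / η := by positivity
        have : 2 / η = 2 * (1 / η) := by ring
        linarith
      exact le_of_sq_le_sq this (by positivity)
    obtain ⟨K, hK⟩ := level_trivial hd hd4 hs1 hη hs2
    have hlev := Col.forall_lt (F := CC) K (fun k _ => level_col hd hd4 hs1 hη hs2
      (m := 2 ^ k) (by positivity))
    have hend : ∀ y ∈ Set.Icc (0 : ℝ) 1, Col CC (fun ψ ψ' => ⌊ψ y / η⌋₊ = ⌊ψ' y / η⌋₊)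
        (2 * η ^ (-(1:ℝ)/2)) := by
      intro y hy
      apply Col.floor (fun ψ : ℝ → ℝ => ψ y / η) (A := 1 / η)
      · intro ψ hψ
        have := hψ.2 y hy
        exact ⟨div_nonneg this.1 hη.le, div_le_div_of_nonneg_right this.2 hη.le⟩
      · exact one_add_le_exp hη
    refine ((hlev.and (hend 0 (by simp))).and (hend 1 (by simp))).mono ?_ ?_
    · have hsum : ∑ k ∈ Finset.range K, 200 * s * (th d s (2 ^ k : ℕ)) ^ (1/2 : ℝ) ≤ 200 * s * C2 := by
        rw [← Finset.mul_sum]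
        refine mul_le_mul_of_nonneg_left ?_ (by positivity)
        refine le_trans (le_of_eq ?_) (hg2 s hs1 K)
        apply Finset.sum_congr rfl
        intro k _
        unfold th
        rw [Real.rpow_mul (le_min (by positivity) (by positivity))]
        push_cast
        rfl
      have h0 : 0 < η ^ (-(1:ℝ)/2) := by positivity
      have : 200 * s * C2 ≤ 400 * C2 * η ^ (-(1:ℝ)/2) := by nlinarith
      have : 0 < C1 * η ^ (-(1:ℝ)/2) := by positivity
      nlinarith
    · rintro a ha b hb ⟨⟨hl, h0⟩, h1⟩ x hx
      have hcont : ∀ ψ ∈ CC, ContinuousAt ψ x := by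
        intro ψ hψ
        have : ConcaveOn ℝ (Set.Ioo (0 : ℝ) 1) ψ :=
          hψ.1.subset Set.Ioo_subset_Icc_self (convex_Ioo _ _)
        exact (this.continuousOn isOpen_Ioo).continuousAt (isOpen_Ioo.mem_nhds hx)
      have hDDsub : ∀ m i, DD m i (fun y => a y - b y) = DD m i a - DD m i b := by
        intro m i; unfold DD; ring
      have hendb : ∀ y ∈ Set.Icc (0 : ℝ) 1, ⌊a y / η⌋₊ = ⌊b y / η⌋₊ → |a y - b y| ≤ η := by
        intro y hy hfl
        have := floor_eq_abs (div_nonneg (ha.2 y hy).1 hη.le) (div_nonneg (hb.2 y hy).1 hη.le) hfl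
        rw [← sub_div, abs_div, abs_of_pos hη, div_le_one hη] at this
        exact this
      set D := (min x (1 - x)) ^ (-d) with hD
      have hD1 := hdist1 x hx
      have hminpos : 0 < min x (1 - x) := lt_min hx.1 (by linarith [hx.2])
      have key := schauder_bound (ψ := fun y => a y - b y) hx ((hcont a ha).sub (hcont b hb))
        (e0 := η) (E := η * C1 * D) (hendb 0 (by simp) h0) (hendb 1 (by simp) h1)
        (fun k => η * th d s ((2 ^ k : ℕ) : ℝ) * D) ?_ ?_
      · have : 0 ≤ (4 + 400 * C2) * η * D := by positivity
        nlinarith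
      · intro k
        rw [hDDsub]
        set m : ℕ := 2 ^ k with hm
        have hmpos : 0 < m := by positivity
        have hm0 : (0 : ℝ) < m := by exact_mod_cast hmpos
        set i := ⌊(m : ℝ) * x⌋₊ with hi
        have i1 : (i : ℝ) ≤ m * x := Nat.floor_le (by have := hx.1; positivity)
        have i2 : m * x < i + 1 := Nat.lt_floor_add_one _
        have him : i < m := by
          have : (i : ℝ) < m := by have := hx.2; nlinarith
          exact_mod_cast this
        have hfl : ⌊DD m i a / unit' d s η m i⌋₊ = ⌊DD m i b / unit' d s η m i⌋₊ := by
          by_cases hk : k < K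
          · exact hl k hk i him
          · rw [hK k (by omega) a ha i him, hK k (by omega) b hb i him]
        have hu := unit'_pos (d := d) hs0 hη him
        have := floor_eq_abs (div_nonneg ((DD_weighted ha hmpos).1 i him) hu.le)
          (div_nonneg ((DD_weighted hb hmpos).1 i him) hu.le) hfl
        rw [← sub_div, abs_div, abs_of_pos hu, div_le_one hu] at this
        refine this.trans ?_
        unfold unit'
        have hth := th_pos (d := d) hs0 hm0
        refine mul_le_mul_of_nonneg_left ?_ (by positivity)
        apply Real.rpow_le_rpow_of_nonpos hminpos ?_ (by linarith)
        rw [le_div_iff₀ hm0]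
        apply le_min
        · have := mul_le_mul_of_nonneg_right (min_le_left x (1 - x)) hm0.le
          linarith
        · have := mul_le_mul_of_nonneg_right (min_le_right x (1 - x)) hm0.le
          linarith
      · intro K'
        have : ∑ k ∈ Finset.range K', η * th d s ((2 ^ k : ℕ) : ℝ) * D =
            η * (∑ k ∈ Finset.range K', th d s ((2 ^ k : ℕ) : ℝ)) * D := by
          rw [Finset.mul_sum, Finset.sum_mul]
        rw [this]
        have h2 := hg1 s hs1 K'
        have h3 : ∑ k ∈ Finset.range K', th d s ((2 ^ k : ℕ) : ℝ) ≤ C1 := by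
          refine le_trans (le_of_eq ?_) h2
          apply Finset.sum_congr rfl
          intro k _
          unfold th; push_cast; rfl
        have hDpos : 0 < D := by linarith
        exact mul_le_mul_of_nonneg_right (mul_le_mul_of_nonneg_left h3 hη.le) hDpos.le

theorem lemA' {d : ℝ} (hd : 0 < d) (hd4 : d ≤ 1/4) : ∃ C > 0, ∀ p q lo R : ℝ, p < q → 0 < R →
    ∀ η > 0, Col {ψ : ℝ → ℝ | ConcaveOn ℝ (Set.Icc p q) ψ ∧
        ∀ x ∈ Set.Icc p q, lo ≤ ψ x ∧ ψ x ≤ lo + R}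
      (fun ψ ψ' => ∀ x ∈ Set.Ioo p q, |ψ x - ψ' x| ≤
        C * η * R * (min ((x - p) / (q - p)) ((q - x) / (q - p))) ^ (-d))
      (C * η ^ (-(1:ℝ)/2)) := by
  obtain ⟨C, hC, h⟩ := lemA hd hd4
  refine ⟨C, hC, ?_⟩
  intro p q lo R hpq hR η hη
  have hw : 0 < q - p := by linarith
  have := (h η hη).comap (F := {ψ : ℝ → ℝ | ConcaveOn ℝ (Set.Icc p q) ψ ∧
        ∀ x ∈ Set.Icc p q, lo ≤ ψ x ∧ ψ x ≤ lo + R})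
    (fun (ψ : ℝ → ℝ) (t : ℝ) => (ψ (p + t * (q - p)) - lo) / R) ?_
  · refine this.mono le_rfl ?_
    intro a _ b _ hab x hx
    have hx1 := hab ((x - p) / (q - p)) ⟨by apply div_pos <;> linarith [hx.1],
      by rw [div_lt_one hw]; linarith [hx.2]⟩
    have e1 : p + (x - p) / (q - p) * (q - p) = x := by field_simp; ring
    have e2 : 1 - (x - p) / (q - p) = (q - x) / (q - p) := by field_simp; ring
    simp only [e1, e2] at hx1
    rw [← sub_div, abs_div, abs_of_pos hR, div_le_iff₀ hR] at hx1
    have e3 : a x - lo - (b x - lo) = a x - b x := by ring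
    rw [e3] at hx1
    linarith
  · rintro ψ ⟨hc, hb⟩
    have hmem : ∀ t ∈ Set.Icc (0 : ℝ) 1, p + t * (q - p) ∈ Set.Icc p q := by
      intro t ht
      have := ht.1; have := ht.2
      constructor <;> nlinarith
    refine ⟨⟨convex_Icc _ _, ?_⟩, ?_⟩
    · intro x hx y hy u v hu hv huv
      have := hc.2 (hmem x hx) (hmem y hy) hu hv huv
      simp only [smul_eq_mul] at this ⊢
      have e : u * (p + x * (q - p)) + v * (p + y * (q - p)) = p + (u * x + v * y) * (q - p) := by
        have : v = 1 - u := by linarith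
        subst this; ring
      rw [e] at this
      have e2 : u * ((ψ (p + x * (q - p)) - lo) / R) + v * ((ψ (p + y * (q - p)) - lo) / R) =
        (u * ψ (p + x * (q - p)) + v * ψ (p + y * (q - p)) - lo) / R := by
        have : v = 1 - u := by linarith
        subst this; field_simp; ring
      rw [e2]
      exact div_le_div_of_nonneg_right (by linarith) hR.le
    · intro x hx
      have := hb _ (hmem x hx)
      exact ⟨div_nonneg (by linarith) hR.le, by rw [div_le_one hR]; linarith⟩

theorem lint_rpow {w : ℝ} (hw : 0 < w) :
    ∫⁻ t in Set.Ioo 0 w, ENNReal.ofReal (t ^ (-(1/4) : ℝ)) ≤ ENNReal.ofReal (4/3 * w ^ (3/4 : ℝ)) := by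
  have hIntg : IntervalIntegrable (fun t : ℝ => t ^ (-(1/4) : ℝ)) volume 0 w :=
    intervalIntegral.intervalIntegrable_rpow' (by norm_num)
  have hI : IntegrableOn (fun t : ℝ => t ^ (-(1/4) : ℝ)) (Set.Ioc 0 w) :=
    (intervalIntegrable_iff_integrableOn_Ioc_of_le hw.le).1 hIntg
  calc ∫⁻ t in Set.Ioo 0 w, ENNReal.ofReal (t ^ (-(1/4) : ℝ))
      ≤ ∫⁻ t in Set.Ioc 0 w, ENNReal.ofReal (t ^ (-(1/4) : ℝ)) :=
        lintegral_mono_set Set.Ioo_subset_Ioc_self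
    _ = ENNReal.ofReal (∫ t in Set.Ioc 0 w, t ^ (-(1/4) : ℝ)) := by
        rw [ofReal_integral_eq_lintegral_ofReal hI]
        filter_upwards [ae_restrict_mem measurableSet_Ioc] with t ht
        exact Real.rpow_nonneg ht.1.le _
    _ ≤ _ := by
        apply ENNReal.ofReal_le_ofReal
        rw [← intervalIntegral.integral_of_le hw.le, integral_rpow (by left; norm_num)]
        norm_num
        apply le_of_eq; ring

theorem lint_piece {p q : ℝ} (hpq : p < q) :
    ∫⁻ x in Set.Ioo p q, ENNReal.ofReal
      ((min ((x - p) / (q - p)) ((q - x) / (q - p))) ^ (-(1/4) : ℝ)) ≤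
      ENNReal.ofReal (3 * (q - p)) := by
  set w := q - p with hw
  have hw0 : 0 < w := by linarith
  set f : ℝ → ℝ≥0∞ := fun t => ENNReal.ofReal (t ^ (-(1/4) : ℝ)) with hf
  have hfm : Measurable f := by simp only [hf]; fun_prop
  set k : ℝ := w ^ (1/4 : ℝ) with hk
  have hk0 : 0 < k := by positivity
  have hbound : ∀ x ∈ Set.Ioo p q, ENNReal.ofReal
      ((min ((x - p) / w) ((q - x) / w)) ^ (-(1/4) : ℝ)) ≤
      ENNReal.ofReal k * (Set.Ioo 0 w).indicator f (x - p) +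
      ENNReal.ofReal k * (Set.Ioo 0 w).indicator f (q - x) := by
    intro x hx
    have h1 : 0 < x - p := by linarith [hx.1]
    have h2 : 0 < q - x := by linarith [hx.2]
    rw [Set.indicator_of_mem (by constructor <;> linarith),
      Set.indicator_of_mem (by constructor <;> linarith)]
    simp only [hf]
    have e : ∀ u : ℝ, 0 < u → (u / w) ^ (-(1/4) : ℝ) = k * u ^ (-(1/4) : ℝ) := by
      intro u hu
      rw [Real.div_rpow hu.le hw0.le, Real.rpow_neg hw0.le]
      field_simp
      rw [hk]
    rw [← ENNReal.ofReal_mul hk0.le, ← ENNReal.ofReal_mul hk0.le, ← e _ h1, ← e _ h2]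
    rcases min_choice ((x - p) / w) ((q - x) / w) with h | h <;> rw [h]
    · exact le_self_add
    · exact le_add_self
  have hind : Measurable ((Set.Ioo 0 w).indicator f) := hfm.indicator measurableSet_Ioo
  have hI : ∫⁻ x, (Set.Ioo 0 w).indicator f x ≤ ENNReal.ofReal (4/3 * w ^ (3/4 : ℝ)) := by
    rw [lintegral_indicator measurableSet_Ioo]; exact lint_rpow hw0
  calc _ ≤ ∫⁻ x in Set.Ioo p q, (ENNReal.ofReal k * (Set.Ioo 0 w).indicator f (x - p) +
      ENNReal.ofReal k * (Set.Ioo 0 w).indicator f (q - x)) :=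
        setLIntegral_mono' measurableSet_Ioo hbound
    _ ≤ ∫⁻ x, (ENNReal.ofReal k * (Set.Ioo 0 w).indicator f (x - p) +
      ENNReal.ofReal k * (Set.Ioo 0 w).indicator f (q - x)) := setLIntegral_le_lintegral _ _
    _ = ENNReal.ofReal k * (∫⁻ x, (Set.Ioo 0 w).indicator f x) +
        ENNReal.ofReal k * (∫⁻ x, (Set.Ioo 0 w).indicator f x) := by
        rw [lintegral_add_left (by fun_prop), lintegral_const_mul _ (by fun_prop),
          lintegral_const_mul _ (by fun_prop), lintegral_sub_right_eq_self,
          lintegral_sub_left_eq_self]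
    _ ≤ ENNReal.ofReal k * ENNReal.ofReal (4/3 * w ^ (3/4 : ℝ)) +
        ENNReal.ofReal k * ENNReal.ofReal (4/3 * w ^ (3/4 : ℝ)) := by gcongr
    _ ≤ _ := by
        rw [← ENNReal.ofReal_mul hk0.le, ← ENNReal.ofReal_add (by positivity) (by positivity)]
        apply ENNReal.ofReal_le_ofReal
        have : k * w ^ (3/4 : ℝ) = w := by
          rw [hk, ← Real.rpow_add hw0]; norm_num
        nlinarith

theorem ConcaveE.quasi {φ : ℝ → EReal} (h : ConcaveE φ) {x y z : ℝ} {a : ℝ} (hx : (a : EReal) ≤ φ x)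
    (hz : (a : EReal) ≤ φ z) (hxy : x ≤ y) (hyz : y ≤ z) : (a : EReal) ≤ φ y := by
  rcases eq_or_lt_of_le (hxy.trans hyz) with he | hlt
  · have : x = y := by linarith
    rwa [← this]
  set θ := (y - x) / (z - x) with hθ
  have hzx : 0 < z - x := by linarith
  have h0 : 0 ≤ θ := div_nonneg (by linarith) hzx.le
  have h1 : θ ≤ 1 := by rw [hθ, div_le_one hzx]; linarith
  have e : (1 - θ) * x + θ * z = y := by rw [hθ]; field_simp; ring
  have := h x z θ h0 h1
  rw [e] at this
  refine le_trans ?_ this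
  have e2 : (a : EReal) = ((1 - θ : ℝ) : EReal) * (a : EReal) + (θ : EReal) * (a : EReal) := by
    rw [← EReal.coe_mul, ← EReal.coe_mul, ← EReal.coe_add]
    congr 1; ring
  rw [e2]
  apply add_le_add
  · exact mul_le_mul_of_nonneg_left hx (by exact_mod_cast (by linarith : (0:ℝ) ≤ 1 - θ))
  · exact mul_le_mul_of_nonneg_left hz (by exact_mod_cast h0)

theorem ConcaveE.neg_comp {φ : ℝ → EReal} (h : ConcaveE φ) : ConcaveE (fun x => φ (-x)) := by
  intro x y θ h0 h1
  have := h (-x) (-y) θ h0 h1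
  have e : (1 - θ) * -x + θ * -y = -((1 - θ) * x + θ * y) := by ring
  rwa [e] at this

theorem ConcaveE.concaveOn {φ : ℝ → EReal} (h : ConcaveE φ) {s : Set ℝ} (hs : Convex ℝ s) {lo hi : ℝ}
    (hb : ∀ x ∈ s, (lo : EReal) ≤ φ x ∧ φ x ≤ hi) :
    ConcaveOn ℝ s (fun x => (φ x).toReal) ∧ ∀ x ∈ s, lo ≤ (φ x).toReal ∧ (φ x).toReal ≤ hi := by
  have hreal : ∀ x ∈ s, ((φ x).toReal : EReal) = φ x := by
    intro x hx
    apply EReal.coe_toReal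
    · exact ne_top_of_le_ne_top (EReal.coe_ne_top _) (hb x hx).2
    · exact ne_bot_of_le_ne_bot (EReal.coe_ne_bot _) (hb x hx).1
  refine ⟨⟨hs, ?_⟩, ?_⟩
  · intro x hx y hy u v hu hv huv
    have hz := hs hx hy hu hv huv
    simp only [smul_eq_mul] at hz ⊢
    have := h x y v hv (by linarith)
    have hu' : 1 - v = u := by linarith
    rw [hu', ← hreal x hx, ← hreal y hy, ← hreal _ hz] at this
    exact_mod_cast this
  · intro x hx
    have := hb x hx
    rw [← hreal x hx] at this
    exact_mod_cast this

def Phi (A B c : ℝ) : Set (ℝ → EReal) :=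
  {φ | ConcaveE φ ∧ (∀ x, φ x ≤ (B : EReal)) ∧ (A : EReal) ≤ φ 0 ∧
    ∀ x, φ x ≤ ((B + 1 - c * (1 + |x|) : ℝ) : EReal)}

noncomputable def yy (B H : ℝ) (j : ℕ) : ℝ := B + 1 - H * 2 ^ j

noncomputable def xs (B H : ℝ) (φ : ℝ → EReal) : ℕ → ℝ
  | 0 => 0
  | j + 1 => sSup {x | 0 ≤ x ∧ (yy B H j : EReal) ≤ φ x}

theorem Phi.neg_comp {A B c : ℝ} {φ : ℝ → EReal} (h : φ ∈ Phi A B c) :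
    (fun x => φ (-x)) ∈ Phi A B c := by
  obtain ⟨h1, h2, h3, h4⟩ := h
  refine ⟨h1.neg_comp, fun x => h2 _, by simpa using h3, fun x => ?_⟩
  have := h4 (-x)
  rwa [abs_neg] at this

theorem xs_aux {A B c H : ℝ} {φ : ℝ → EReal} (hc : 0 < c) (hφ : φ ∈ Phi A B c)
    {j : ℕ} {x : ℝ} (hx : 0 ≤ x) (h : (yy B H j : EReal) ≤ φ x) :
    x ≤ H / c * 2 ^ j := by
  have h1 := h.trans (hφ.2.2.2 x)
  have h2 : yy B H j ≤ B + 1 - c * (1 + |x|) := by exact_mod_cast h1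
  unfold yy at h2
  rw [abs_of_nonneg hx] at h2
  rw [div_mul_eq_mul_div, le_div_iff₀ hc]
  nlinarith

theorem xs_bdd {A B c H : ℝ} {φ : ℝ → EReal} (hc : 0 < c) (hφ : φ ∈ Phi A B c)
    (j : ℕ) : BddAbove {x | 0 ≤ x ∧ (yy B H j : EReal) ≤ φ x} :=
  ⟨H / c * 2 ^ j, fun _ hx => xs_aux hc hφ hx.1 hx.2⟩

theorem xs_zero_mem {A B c H : ℝ} {φ : ℝ → EReal} (hH : 1 ≤ H) (hHA : B + 1 - H ≤ A) (hφ : φ ∈ Phi A B c)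
    (j : ℕ) : (0 : ℝ) ∈ {x | 0 ≤ x ∧ (yy B H j : EReal) ≤ φ x} := by
  refine ⟨le_rfl, le_trans ?_ hφ.2.2.1⟩
  have : yy B H j ≤ A := by
    unfold yy
    have : (1:ℝ) ≤ 2 ^ j := one_le_pow₀ (by norm_num)
    nlinarith
  exact_mod_cast this

theorem xs_nonneg {A B c H : ℝ} {φ : ℝ → EReal} (hc : 0 < c) (hH : 1 ≤ H) (hHA : B + 1 - H ≤ A) (hφ : φ ∈ Phi A B c)
    (j : ℕ) : 0 ≤ xs B H φ j := by
  cases j with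
  | zero => exact le_rfl
  | succ j => exact le_csSup (xs_bdd hc hφ j) (xs_zero_mem hH hHA hφ j)

theorem xs_le {A B c H : ℝ} {φ : ℝ → EReal} (hc : 0 < c) (hH : 1 ≤ H) (hHA : B + 1 - H ≤ A) (hφ : φ ∈ Phi A B c)
    (j : ℕ) : xs B H φ j ≤ H / c * 2 ^ j := by
  cases j with
  | zero => simp only [xs]; positivity
  | succ j =>
    refine (csSup_le ⟨0, xs_zero_mem hH hHA hφ j⟩ (fun x hx => xs_aux hc hφ hx.1 hx.2)).trans ?_
    rw [pow_succ]
    have : 0 ≤ H / c * 2 ^ j := by positivity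
    nlinarith

theorem xs_below {A B c H : ℝ} {φ : ℝ → EReal} (hH : 1 ≤ H) (hHA : B + 1 - H ≤ A) (hφ : φ ∈ Phi A B c)
    {j : ℕ} {x : ℝ} (h0 : 0 ≤ x) (hx : x < xs B H φ (j+1)) :
    (yy B H j : EReal) ≤ φ x := by
  obtain ⟨z, hz, hxz⟩ := exists_lt_of_lt_csSup ⟨0, xs_zero_mem hH hHA hφ j⟩ hx
  exact hφ.1.quasi (xs_zero_mem hH hHA hφ j).2 hz.2 h0 hxz.le

theorem xs_above {A B c H : ℝ} {φ : ℝ → EReal} (hc : 0 < c) (hH : 1 ≤ H) (hHA : B + 1 - H ≤ A) (hφ : φ ∈ Phi A B c)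
    {j : ℕ} {x : ℝ} (hx : xs B H φ j < x) :
    φ x ≤ ((B + 1 - max 1 (2 ^ j / 2) : ℝ) : EReal) := by
  cases j with
  | zero =>
    have : (B + 1 - max 1 (2 ^ 0 / 2) : ℝ) = B := by norm_num
    rw [this]; exact hφ.2.1 x
  | succ j =>
    have hx0 : 0 ≤ x := (xs_nonneg hc hH hHA hφ (j+1)).trans hx.le
    have h1 : φ x < (yy B H j : EReal) := by
      by_contra hcon
      exact absurd (le_csSup (xs_bdd hc hφ j) ⟨hx0, not_lt.1 hcon⟩) (not_le.2 hx)
    refine h1.le.trans ?_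
    have : yy B H j ≤ B + 1 - max 1 (2 ^ (j+1) / 2) := by
      unfold yy
      have h2 : (1:ℝ) ≤ 2 ^ j := one_le_pow₀ (by norm_num)
      have h3 : max 1 ((2:ℝ) ^ (j+1) / 2) ≤ H * 2 ^ j := by
        apply max_le
        · nlinarith
        · rw [pow_succ]; nlinarith
      linarith
    exact_mod_cast this

def GH (G : EReal → ℝ) (B D α : ℝ) : Prop :=
  (∀ t : ℝ, 1 ≤ t → ∀ y1 y2 : ℝ, y1 ≤ B + 1 - t → y2 ≤ B + 1 - t →
    |G y1 - G y2| ≤ D * t ^ (-(α+1)) * |y1 - y2|) ∧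
  (∀ t : ℝ, 1 ≤ t → ∀ y : EReal, y ≤ ((B + 1 - t : ℝ) : EReal) → 0 ≤ G y ∧ G y ≤ D * t ^ (-α))

noncomputable def pL (ρ : ℝ) (m : ℕ) : ℝ := (m + 1) * ρ
noncomputable def pR (ρ : ℝ) (n : ℕ) : ℝ := (n - 1) * ρ

theorem pow_two_aux {α : ℝ} (hα : 0 < α) (j : ℕ) :
    (max 1 ((2:ℝ) ^ j / 2)) ^ (-α) ≤ 2 ^ α * ((2:ℝ) ^ (-α)) ^ j := by
  have h1 : ((2:ℝ) ^ j / 2) ^ (-α) = 2 ^ α * ((2:ℝ) ^ (-α)) ^ j := by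
    rw [Real.div_rpow (by positivity) (by norm_num), Real.rpow_neg (by norm_num : (0:ℝ) ≤ 2)]
    rw [← Real.rpow_natCast, ← Real.rpow_mul (by norm_num), inv_pow, ← Real.rpow_natCast,
      ← Real.rpow_mul (by norm_num), mul_neg, Real.rpow_neg (by norm_num)]
    rw [mul_comm α]; field_simp
  rw [← h1]
  exact Real.rpow_le_rpow_of_nonpos (by positivity) (le_max_right _ _) (by linarith)

theorem piece_col {A B c H D α d : ℝ} (hc : 0 < c) (hH : 1 ≤ H) (hHA : B + 1 - H ≤ A)
    (hD : 0 < D) (hα : 0 < α) (hd : 0 < d) (hd4 : d ≤ 1/4) {G : EReal → ℝ} (hG : GH G B D α) :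
    ∃ C > 0, ∀ ρ > 0, ∀ η > 0, ∀ j : ℕ, Col (Phi A B c) (fun φ φ' =>
      (⌊xs B H φ j / ρ⌋₊ = ⌊xs B H φ' j / ρ⌋₊ ∧ ⌊xs B H φ (j+1) / ρ⌋₊ = ⌊xs B H φ' (j+1) / ρ⌋₊) →
      ∀ x ∈ Set.Ioo (pL ρ ⌊xs B H φ j / ρ⌋₊) (pR ρ ⌊xs B H φ (j+1) / ρ⌋₊),
        |G (φ x) - G (φ' x)| ≤ C * η * ((2:ℝ) ^ (-α)) ^ j *
          (min ((x - pL ρ ⌊xs B H φ j / ρ⌋₊) /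
              (pR ρ ⌊xs B H φ (j+1) / ρ⌋₊ - pL ρ ⌊xs B H φ j / ρ⌋₊))
            ((pR ρ ⌊xs B H φ (j+1) / ρ⌋₊ - x) /
              (pR ρ ⌊xs B H φ (j+1) / ρ⌋₊ - pL ρ ⌊xs B H φ j / ρ⌋₊))) ^ (-d))
      (C * η ^ (-(1:ℝ)/2)) := by
  obtain ⟨C, hC, hl⟩ := lemA' hd hd4
  have hH0 : 0 < H := by linarith
  set C' := C + D * 2 ^ (α+1) * C * H with hC'
  have hC'0 : C ≤ C' := by rw [hC']; have : 0 ≤ D * 2 ^ (α+1) * C * H := by positivity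
                           linarith
  refine ⟨C', by linarith, ?_⟩
  intro ρ hρ η hη j
  have hdep := Col.dep (F := Phi A B c) (L := C' * η ^ (-(1:ℝ)/2))
    (R := fun φ φ' => ∀ x ∈ Set.Ioo (pL ρ ⌊xs B H φ j / ρ⌋₊) (pR ρ ⌊xs B H φ (j+1) / ρ⌋₊),
        |G (φ x) - G (φ' x)| ≤ C' * η * ((2:ℝ) ^ (-α)) ^ j *
          (min ((x - pL ρ ⌊xs B H φ j / ρ⌋₊) /
              (pR ρ ⌊xs B H φ (j+1) / ρ⌋₊ - pL ρ ⌊xs B H φ j / ρ⌋₊))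
            ((pR ρ ⌊xs B H φ (j+1) / ρ⌋₊ - x) /
              (pR ρ ⌊xs B H φ (j+1) / ρ⌋₊ - pL ρ ⌊xs B H φ j / ρ⌋₊))) ^ (-d))
    (fun φ => (⌊xs B H φ j / ρ⌋₊, ⌊xs B H φ (j+1) / ρ⌋₊)) ?_
  · refine hdep.mono le_rfl ?_
    intro a _ b _ h hk
    exact h (Prod.ext hk.1 hk.2)
  · rintro ⟨m, n⟩
    by_cases hpq : pL ρ m < pR ρ n
    swap
    · refine Col.trivial (by positivity) ?_
      rintro a ⟨_, ha⟩ b _ x hx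
      simp only [Prod.mk.injEq] at ha
      rw [ha.1, ha.2] at hx
      exact absurd (hx.1.trans hx.2) hpq
    have hfl : ∀ φ ∈ {a ∈ Phi A B c | (⌊xs B H a j / ρ⌋₊, ⌊xs B H a (j+1) / ρ⌋₊) = (m, n)},
        xs B H φ j < pL ρ m ∧ pR ρ n < xs B H φ (j+1) := by
      rintro φ ⟨hφ, hk⟩
      simp only [Prod.mk.injEq] at hk
      have h1 := Nat.lt_floor_add_one (xs B H φ j / ρ)
      have h2 := Nat.floor_le (div_nonneg (xs_nonneg hc hH hHA hφ (j+1)) hρ.le)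
      rw [hk.1, div_lt_iff₀ hρ] at h1
      rw [hk.2, le_div_iff₀ hρ] at h2
      refine ⟨h1, ?_⟩
      unfold pR; linarith
    have hb : ∀ φ ∈ {a ∈ Phi A B c | (⌊xs B H a j / ρ⌋₊, ⌊xs B H a (j+1) / ρ⌋₊) = (m, n)},
        ∀ x ∈ Set.Icc (pL ρ m) (pR ρ n), (yy B H j : EReal) ≤ φ x ∧
          φ x ≤ ((B + 1 - max 1 (2 ^ j / 2) : ℝ) : EReal) := by
      intro φ hφ x hx
      have := hfl φ hφ
      have hx0 : 0 ≤ x := by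
        have : 0 ≤ pL ρ m := by unfold pL; positivity
        linarith [hx.1]
      exact ⟨xs_below hH hHA hφ.1 hx0 (by linarith [hx.2]),
        xs_above hc hH hHA hφ.1 (by linarith [hx.1])⟩
    have hcol := (hl (pL ρ m) (pR ρ n) (yy B H j) (H * 2 ^ j) hpq (by positivity) η hη).comap
      (F := {a ∈ Phi A B c | (⌊xs B H a j / ρ⌋₊, ⌊xs B H a (j+1) / ρ⌋₊) = (m, n)})
      (fun φ x => (φ x).toReal) ?_
    · refine hcol.mono (by gcongr) ?_
      intro a ha b hb' hab x hx
      have hka := ha.2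
      simp only [Prod.mk.injEq] at hka
      rw [hka.1, hka.2] at hx ⊢
      have hxab := hab x hx
      have hxI := Set.Ioo_subset_Icc_self hx
      have ca := hb a ha x hxI
      have cb := hb b hb' x hxI
      have ra : ((a x).toReal : EReal) = a x := EReal.coe_toReal
        (ne_top_of_le_ne_top (EReal.coe_ne_top _) ca.2)
        (ne_bot_of_le_ne_bot (EReal.coe_ne_bot _) ca.1)
      have rb : ((b x).toReal : EReal) = b x := EReal.coe_toReal
        (ne_top_of_le_ne_top (EReal.coe_ne_top _) cb.2)
        (ne_bot_of_le_ne_bot (EReal.coe_ne_bot _) cb.1)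
      rw [← ra] at ca
      rw [← rb] at cb
      have hg := hG.1 (max 1 (2 ^ j / 2)) (le_max_left _ _) (a x).toReal (b x).toReal
        (by exact_mod_cast ca.2) (by exact_mod_cast cb.2)
      rw [ra, rb] at hg
      refine hg.trans ?_
      set Q := (min ((x - pL ρ m) / (pR ρ n - pL ρ m)) ((pR ρ n - x) / (pR ρ n - pL ρ m))) ^ (-d)
        with hQ
      have hQ0 : 0 ≤ Q := by
        apply Real.rpow_nonneg
        apply le_min <;> apply div_nonneg <;> linarith [hx.1, hx.2]
      have h2 := pow_two_aux (α := α + 1) (by linarith) j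
      have h3 : ((2:ℝ) ^ (-(α+1))) ^ j * 2 ^ j = ((2:ℝ) ^ (-α)) ^ j := by
        rw [← mul_pow]
        congr 1
        nth_rewrite 2 [← Real.rpow_one 2]
        rw [← Real.rpow_add (by norm_num)]
        congr 1; ring
      calc D * (max 1 (2 ^ j / 2)) ^ (-(α+1)) * |(a x).toReal - (b x).toReal|
          ≤ D * (2 ^ (α+1) * ((2:ℝ) ^ (-(α+1))) ^ j) * (C * η * (H * 2 ^ j) * Q) := by
            gcongr
        _ = (D * 2 ^ (α+1) * C * H) * η * (((2:ℝ) ^ (-(α+1))) ^ j * 2 ^ j) * Q := by ring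
        _ ≤ C' * η * ((2:ℝ) ^ (-α)) ^ j * Q := by
            rw [h3]
            gcongr
            rw [hC']; linarith
    · intro φ hφ
      have hh := hb φ hφ
      have h1 := hφ.1.1.concaveOn (convex_Icc (pL ρ m) (pR ρ n)) (lo := yy B H j)
        (hi := yy B H j + H * 2 ^ j) (fun x hx => ⟨(hh x hx).1, (hh x hx).2.trans ?_⟩)
      · exact h1
      · have : B + 1 - max 1 (2 ^ j / 2) ≤ yy B H j + H * 2 ^ j := by
          unfold yy
          have := le_max_left (1:ℝ) (2 ^ j / 2)
          linarith
        exact_mod_cast this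

noncomputable def aC (B H ρ : ℝ) (φ : ℝ → EReal) (j : ℕ) : ℕ := ⌊xs B H φ j / ρ⌋₊

noncomputable def mf (p q x : ℝ) : ℝ := min ((x - p) / (q - p)) ((q - x) / (q - p))

theorem xs_lt_pL {B H ρ : ℝ} (hρ : 0 < ρ) (φ : ℝ → EReal) (j : ℕ) :
    xs B H φ j < pL ρ (aC B H ρ φ j) := by
  have h1 := Nat.lt_floor_add_one (xs B H φ j / ρ)
  rw [div_lt_iff₀ hρ] at h1
  exact h1

theorem pR_le_xs {A B c H ρ : ℝ} {φ : ℝ → EReal} (hc : 0 < c) (hH : 1 ≤ H) (hHA : B + 1 - H ≤ A)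
    (hφ : φ ∈ Phi A B c) (hρ : 0 < ρ) (j : ℕ) :
    pR ρ (aC B H ρ φ j) ≤ xs B H φ j := by
  have h2 := Nat.floor_le (div_nonneg (xs_nonneg hc hH hHA hφ j) hρ.le)
  rw [le_div_iff₀ hρ] at h2
  unfold pR aC; linarith

theorem coverage {B H ρ : ℝ} (hρ : 0 < ρ) (φ : ℝ → EReal) {x : ℝ} (hx : 0 ≤ x) (J : ℕ) :
    (∃ j < J, x ∈ Set.Ioo (pL ρ (aC B H ρ φ j)) (pR ρ (aC B H ρ φ (j+1)))) ∨
    (∃ j < J + 1, x ∈ Set.Icc (pR ρ (aC B H ρ φ j)) (pL ρ (aC B H ρ φ j))) ∨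
    pL ρ (aC B H ρ φ J) < x := by
  induction J with
  | zero =>
    by_cases h : x ≤ pL ρ (aC B H ρ φ 0)
    · right; left
      refine ⟨0, by norm_num, ?_, h⟩
      simp only [aC, xs, pR]
      simp
      linarith
    · right; right; exact not_le.1 h
  | succ J ih =>
    rcases ih with ⟨j, hj, h⟩ | ⟨j, hj, h⟩ | h
    · left; exact ⟨j, by omega, h⟩
    · right; left; exact ⟨j, by omega, h⟩
    · by_cases h1 : x < pR ρ (aC B H ρ φ (J+1))
      · left; exact ⟨J, by omega, h, h1⟩
      · by_cases h2 : x ≤ pL ρ (aC B H ρ φ (J+1))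
        · right; left; exact ⟨J+1, by omega, not_lt.1 h1, h2⟩
        · right; right; exact not_le.1 h2

theorem envelope {A B c D α : ℝ} (hc : 0 < c) (hD : 0 < D) (hα : 0 < α) {G : EReal → ℝ}
    (hG : GH G B D α) {φ : ℝ → EReal} (hφ : φ ∈ Phi A B c) (x : ℝ) :
    0 ≤ G (φ x) ∧ G (φ x) ≤ D ∧ G (φ x) ≤ D * (c * (1 + |x|)) ^ (-α) := by
  have h1 := hG.2 1 le_rfl (φ x) (by simpa using hφ.2.1 x)
  rw [Real.one_rpow, mul_one] at h1
  refine ⟨h1.1, h1.2, ?_⟩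
  by_cases h : 1 ≤ c * (1 + |x|)
  · exact (hG.2 _ h (φ x) (hφ.2.2.2 x)).2
  · refine h1.2.trans ?_
    have : 1 ≤ (c * (1 + |x|)) ^ (-α) :=
      Real.one_le_rpow_of_pos_of_le_one_of_nonpos (by positivity) (not_le.1 h).le (by linarith)
    nlinarith

theorem interp {K g u v l : ℝ} (hK : 0 ≤ K) (hg : 0 ≤ g) (hu : 0 ≤ u) (hv : 0 ≤ v)
    (h0 : 0 < l) (h1 : l < 1) (h2 : g ≤ K * u) (h3 : g ≤ K * v) : g ≤ K * (u ^ l * v ^ (1 - l)) := by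
  rcases hg.eq_or_lt with h | h
  · rw [← h]; positivity
  calc g = g ^ l * g ^ (1 - l) := by
        rw [← Real.rpow_add h]; simp
    _ ≤ (K * u) ^ l * (K * v) ^ (1 - l) := by
        apply mul_le_mul
        · exact Real.rpow_le_rpow hg h2 h0.le
        · exact Real.rpow_le_rpow hg h3 (by linarith)
        · positivity
        · positivity
    _ = (K ^ l * K ^ (1 - l)) * (u ^ l * v ^ (1 - l)) := by
        rw [Real.mul_rpow hK hu, Real.mul_rpow hK hv]; ring
    _ = K * (u ^ l * v ^ (1 - l)) := by
        have : 0 < K := by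
          by_contra hcon
          have : K = 0 := le_antisymm (not_lt.1 hcon) hK
          rw [this] at h2; linarith
        rw [← Real.rpow_add this]; simp

theorem tail_bound {A B c H D α κ ε ρ : ℝ} (hc : 0 < c) (hH : 1 ≤ H) (hHA : B + 1 - H ≤ A)
    (hD : 0 < D) (hκ : 0 < κ) (hκα : κ < α) {G : EReal → ℝ} (hG : GH G B D α) (hρ : 0 < ρ)
    (hε : 0 < ε) (J : ℕ) (hJ : 1 / ε ≤ ((2:ℝ) ^ κ) ^ J)
    {φ : ℝ → EReal} (hφ : φ ∈ Phi A B c) {x : ℝ} (hx : pL ρ (aC B H ρ φ J) < x) :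
    G (φ x) ≤ (D * 2 ^ α + D * c ^ (-α)) * ε * (1 + |x|) ^ (-(α - κ)) := by
  have hα : 0 < α := hκ.trans hκα
  obtain ⟨e1, e2, e3⟩ := envelope hc hD hα hG hφ x
  have h1 := hG.2 _ (le_max_left _ _) (φ x) (xs_above hc hH hHA hφ ((xs_lt_pL hρ φ J).trans hx))
  have h2 := pow_two_aux hα J
  set K := D * 2 ^ α + D * c ^ (-α) with hK
  have k1 : 0 ≤ D * 2 ^ α := by positivity
  have k2 : 0 ≤ D * c ^ (-α) := by positivity
  set u := ((2:ℝ) ^ (-α)) ^ J with hu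
  set v := (1 + |x|) ^ (-α) with hv
  have hu0 : 0 ≤ u := by positivity
  have hv0 : 0 ≤ v := by positivity
  have b1 : G (φ x) ≤ K * u := by
    have : G (φ x) ≤ D * (2 ^ α * u) := h1.2.trans (by gcongr)
    nlinarith
  have b2 : G (φ x) ≤ K * v := by
    rw [Real.mul_rpow hc.le (by positivity)] at e3
    nlinarith
  have := interp (l := κ / α) (by linarith) e1 hu0 hv0 (by positivity)
    (by rw [div_lt_one hα]; exact hκα) b1 b2
  have eu : u ^ (κ / α) ≤ ε := by
    have : u ^ (κ/α) = (((2:ℝ) ^ κ) ^ J)⁻¹ := by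
      rw [hu, ← Real.rpow_natCast, ← Real.rpow_mul (by positivity), ← Real.rpow_mul (by norm_num),
        ← Real.rpow_natCast, ← Real.rpow_mul (by norm_num), ← Real.rpow_neg (by norm_num)]
      congr 1; field_simp
    rw [this]
    apply inv_le_of_inv_le₀ hε
    rwa [← one_div]
  have ev : v ^ (1 - κ/α) = (1 + |x|) ^ (-(α - κ)) := by
    rw [hv, ← Real.rpow_mul (by positivity)]
    congr 1; field_simp
  rw [ev] at this
  calc _ ≤ _ := this
    _ ≤ K * (ε * (1 + |x|) ^ (-(α - κ))) := by
        gcongr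
    _ = _ := by ring

noncomputable def WW (B H ρ C ε s a d r D K τ : ℝ) (J : ℕ) (φ : ℝ → EReal) (x : ℝ) : ℝ≥0∞ :=
  (∑ j ∈ Finset.range J, (Set.Ioo (pL ρ (aC B H ρ φ j)) (pR ρ (aC B H ρ φ (j+1)))).indicator
    (fun x => ENNReal.ofReal ((C * (ε * s ^ j) * a ^ j *
      (mf (pL ρ (aC B H ρ φ j)) (pR ρ (aC B H ρ φ (j+1))) x) ^ (-d)) ^ r)) x) +
  (∑ j ∈ Finset.range (J+1), (Set.Icc (pR ρ (aC B H ρ φ j)) (pL ρ (aC B H ρ φ j))).indicator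
    (fun _ => ENNReal.ofReal (D ^ r)) x) +
  ENNReal.ofReal ((K * ε * (1 + |x|) ^ (-τ)) ^ r)

theorem WW_ne_top (B H ρ C ε s a d r D K τ : ℝ) (J : ℕ) (φ : ℝ → EReal) (x : ℝ) :
    WW B H ρ C ε s a d r D K τ J φ x ≠ ⊤ := by
  unfold WW
  refine ENNReal.add_ne_top.2 ⟨ENNReal.add_ne_top.2 ⟨?_, ?_⟩, ENNReal.ofReal_ne_top⟩
  · refine ENNReal.sum_ne_top.2 fun j _ => ?_
    unfold Set.indicator; split_ifs <;> simp
  · refine ENNReal.sum_ne_top.2 fun j _ => ?_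
    unfold Set.indicator; split_ifs <;> simp

theorem WW_measurable (B H ρ C ε s a d r D K τ : ℝ) (J : ℕ) (φ : ℝ → EReal) :
    Measurable (WW B H ρ C ε s a d r D K τ J φ) := by
  unfold WW mf
  refine (Measurable.add ?_ ?_).add ?_
  · refine Finset.measurable_sum _ fun j _ => Measurable.indicator ?_ measurableSet_Ioo
    fun_prop
  · refine Finset.measurable_sum _ fun j _ => Measurable.indicator ?_ measurableSet_Icc
    fun_prop
  · fun_prop

theorem tail_int {τ r : ℝ} (h : 1 < τ * r) : ∃ T > 0,
    ∫⁻ x : ℝ, ENNReal.ofReal (((1 + |x|) ^ (-τ)) ^ r) ≤ ENNReal.ofReal T := by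
  have h1 := finite_integral_one_add_norm (E := ℝ) (μ := volume) (r := τ * r) (by simpa using h)
  refine ⟨(∫⁻ x : ℝ, ENNReal.ofReal ((1 + ‖x‖) ^ (-(τ * r)))).toReal + 1, by positivity, ?_⟩
  rw [ENNReal.ofReal_add (by positivity) (by norm_num), ENNReal.ofReal_toReal h1.ne]
  refine le_trans (le_of_eq ?_) le_self_add
  congr 1; ext x
  rw [← Real.rpow_mul (by positivity), Real.norm_eq_abs]
  congr 2; ring

theorem piece_int {Cj d r p q Q : ℝ} (hC : 0 ≤ Cj) (hdr : d * r = 1/4)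
    (hQ : q - p ≤ Q) (hQ0 : 0 ≤ Q) :
    ∫⁻ x, (Set.Ioo p q).indicator (fun x => ENNReal.ofReal ((Cj * (mf p q x) ^ (-d)) ^ r)) x ≤
      ENNReal.ofReal (Cj ^ r * (3 * Q)) := by
  rw [lintegral_indicator measurableSet_Ioo]
  by_cases hpq : p < q
  swap
  · rw [Set.Ioo_eq_empty hpq]; simp
  calc ∫⁻ x in Set.Ioo p q, ENNReal.ofReal ((Cj * (mf p q x) ^ (-d)) ^ r)
      ≤ ∫⁻ x in Set.Ioo p q, ENNReal.ofReal (Cj ^ r) *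
        ENNReal.ofReal ((mf p q x) ^ (-(1/4) : ℝ)) := by
        apply setLIntegral_mono' measurableSet_Ioo
        intro x hx
        have hm : 0 ≤ mf p q x := by
          unfold mf
          apply le_min <;> apply div_nonneg <;> linarith [hx.1, hx.2]
        rw [← ENNReal.ofReal_mul (by positivity), Real.mul_rpow hC (by positivity),
          ← Real.rpow_mul hm]
        apply le_of_eq
        congr 3
        linarith
    _ = ENNReal.ofReal (Cj ^ r) * ∫⁻ x in Set.Ioo p q,
        ENNReal.ofReal ((mf p q x) ^ (-(1/4) : ℝ)) := by
        rw [lintegral_const_mul]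
        unfold mf; fun_prop
    _ ≤ ENNReal.ofReal (Cj ^ r) * ENNReal.ofReal (3 * (q - p)) := by
        gcongr
        exact lint_piece hpq
    _ ≤ _ := by
        rw [← ENNReal.ofReal_mul (by positivity)]
        apply ENNReal.ofReal_le_ofReal
        gcongr

theorem gap_int {D r ρ : ℝ} (hρ : 0 < ρ) (hD : 0 < D) (m : ℕ) :
    ∫⁻ x, (Set.Icc (pR ρ m) (pL ρ m)).indicator (fun _ => ENNReal.ofReal (D ^ r)) x ≤
      ENNReal.ofReal (D ^ r * (2 * ρ)) := by
  rw [lintegral_indicator measurableSet_Icc, lintegral_const, Measure.restrict_apply MeasurableSet.univ,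
    Set.univ_inter, Real.volume_Icc, ← ENNReal.ofReal_mul (by positivity)]
  apply le_of_eq
  congr 2
  unfold pL pR; ring

theorem geo_le {b : ℝ} (h0 : 0 ≤ b) (h1 : b < 1) (J : ℕ) :
    ∑ j ∈ Finset.range J, b ^ j ≤ (1 - b)⁻¹ := by
  have := Summable.sum_le_tsum (Finset.range J) (fun i _ => pow_nonneg h0 i)
    (summable_geometric_of_lt_one h0 h1)
  rwa [tsum_geometric_of_lt_one h0 h1] at this

theorem WW_int {A B c H ρ C ε s a d r D K τ T P : ℝ} {J : ℕ} (hc : 0 < c) (hH : 1 ≤ H)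
    (hHA : B + 1 - H ≤ A) (hρ : 0 < ρ) (hρe : ρ ≤ ε ^ r * ε) (hC : 0 < C) (hε : 0 < ε) (hs : 0 < s)
    (ha : 0 < a) (hdr : d * r = 1/4) (hD : 0 < D) (hK : 0 < K)
    (hb : (s * a) ^ r * 2 < 1)
    (hP : (J + 1) * ε ≤ P)
    (hT0 : 0 < T) (hT : ∫⁻ x : ℝ, ENNReal.ofReal (((1 + |x|) ^ (-τ)) ^ r) ≤ ENNReal.ofReal T)
    {φ : ℝ → EReal} (hφ : φ ∈ Phi A B c) :
    ∫⁻ x, WW B H ρ C ε s a d r D K τ J φ x ≤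
      ENNReal.ofReal ((C ^ r * (6 * (H / c)) * (1 - (s * a) ^ r * 2)⁻¹ + 2 * D ^ r * P + K ^ r * T) * ε ^ r) := by
  have hm1 : ∀ j, Measurable (fun x => (Set.Ioo (pL ρ (aC B H ρ φ j)) (pR ρ (aC B H ρ φ (j+1)))).indicator
    (fun x => ENNReal.ofReal ((C * (ε * s ^ j) * a ^ j *
      (mf (pL ρ (aC B H ρ φ j)) (pR ρ (aC B H ρ φ (j+1))) x) ^ (-d)) ^ r)) x) := by
    intro j
    apply Measurable.indicator ?_ measurableSet_Ioo
    unfold mf; fun_prop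
  have hm2 : ∀ j, Measurable (fun x => (Set.Icc (pR ρ (aC B H ρ φ j)) (pL ρ (aC B H ρ φ j))).indicator
    (fun _ => ENNReal.ofReal (D ^ r)) x) := by
    intro j
    apply Measurable.indicator ?_ measurableSet_Icc
    fun_prop
  have hsplit : ∫⁻ x, WW B H ρ C ε s a d r D K τ J φ x =
      (∑ j ∈ Finset.range J, ∫⁻ x, (Set.Ioo (pL ρ (aC B H ρ φ j)) (pR ρ (aC B H ρ φ (j+1)))).indicator
        (fun x => ENNReal.ofReal ((C * (ε * s ^ j) * a ^ j *
        (mf (pL ρ (aC B H ρ φ j)) (pR ρ (aC B H ρ φ (j+1))) x) ^ (-d)) ^ r)) x) +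
      (∑ j ∈ Finset.range (J+1), ∫⁻ x, (Set.Icc (pR ρ (aC B H ρ φ j)) (pL ρ (aC B H ρ φ j))).indicator
        (fun _ => ENNReal.ofReal (D ^ r)) x) +
      ∫⁻ x, ENNReal.ofReal ((K * ε * (1 + |x|) ^ (-τ)) ^ r) := by
    unfold WW
    rw [lintegral_add_right _ (by fun_prop), lintegral_add_right,
      lintegral_finsetSum _ (fun j _ => hm1 j), lintegral_finsetSum _ (fun j _ => hm2 j)]
    exact Finset.measurable_sum _ fun j _ => hm2 j
  rw [hsplit]
  set X := H / c with hX
  have hX0 : 0 < X := by rw [hX]; positivity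
  set b := (s * a) ^ r * 2 with hbdef
  have hb0 : 0 ≤ b := by positivity
  have e1 : (∑ j ∈ Finset.range J, ∫⁻ x, (Set.Ioo (pL ρ (aC B H ρ φ j)) (pR ρ (aC B H ρ φ (j+1)))).indicator
        (fun x => ENNReal.ofReal ((C * (ε * s ^ j) * a ^ j *
        (mf (pL ρ (aC B H ρ φ j)) (pR ρ (aC B H ρ φ (j+1))) x) ^ (-d)) ^ r)) x) ≤
      ENNReal.ofReal (C ^ r * (6 * X) * (1 - b)⁻¹ * ε ^ r) := by
    calc _ ≤ ∑ j ∈ Finset.range J, ENNReal.ofReal (C ^ r * (6 * X) * ε ^ r * b ^ j) := by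
          apply Finset.sum_le_sum
          intro j _
          refine (piece_int (Q := X * 2 ^ (j+1)) (by positivity) hdr ?_ (by positivity)).trans ?_
          · have h1 := pR_le_xs hc hH hHA hφ hρ (j+1)
            have h2 := xs_le hc hH hHA hφ (j+1)
            have h3 : 0 ≤ pL ρ (aC B H ρ φ j) := by unfold pL; positivity
            linarith
          · apply ENNReal.ofReal_le_ofReal
            apply le_of_eq
            have : C * (ε * s ^ j) * a ^ j = C * ε * (s * a) ^ j := by rw [mul_pow]; ring
            rw [this, Real.mul_rpow (by positivity) (by positivity), Real.mul_rpow hC.le hε.le,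
              hbdef]
            have : ((s * a) ^ j) ^ r = ((s * a) ^ r) ^ j := by
              rw [← Real.rpow_natCast, ← Real.rpow_mul (by positivity), mul_comm (j : ℝ),
                Real.rpow_mul (by positivity), Real.rpow_natCast]
            rw [this, mul_pow _ (2 : ℝ), pow_succ]; ring
      _ = ENNReal.ofReal (C ^ r * (6 * X) * ε ^ r * ∑ j ∈ Finset.range J, b ^ j) := by
          rw [Finset.mul_sum, ENNReal.ofReal_sum_of_nonneg]
          intro j _; positivity
      _ ≤ _ := by
          apply ENNReal.ofReal_le_ofReal
          have := geo_le hb0 hb J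
          have h0 : 0 ≤ C ^ r * (6 * X) * ε ^ r := by positivity
          nlinarith
  have e2 : (∑ j ∈ Finset.range (J+1), ∫⁻ x, (Set.Icc (pR ρ (aC B H ρ φ j)) (pL ρ (aC B H ρ φ j))).indicator
        (fun _ => ENNReal.ofReal (D ^ r)) x) ≤ ENNReal.ofReal (2 * D ^ r * P * ε ^ r) := by
    calc _ ≤ ∑ j ∈ Finset.range (J+1), ENNReal.ofReal (D ^ r * (2 * ρ)) :=
          Finset.sum_le_sum fun j _ => gap_int hρ hD _
      _ = ENNReal.ofReal ((J+1) * (D ^ r * (2 * ρ))) := by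
          rw [Finset.sum_const, Finset.card_range, nsmul_eq_mul, ← ENNReal.ofReal_natCast,
            ← ENNReal.ofReal_mul (Nat.cast_nonneg _)]
          push_cast; rfl
      _ ≤ _ := by
          apply ENNReal.ofReal_le_ofReal
          calc (J+1) * (D ^ r * (2 * ρ)) ≤ (J+1) * (D ^ r * (2 * (ε ^ r * ε))) := by gcongr
            _ = 2 * D ^ r * ((J+1) * ε) * ε ^ r := by ring
            _ ≤ _ := by gcongr
  have e3 : ∫⁻ x, ENNReal.ofReal ((K * ε * (1 + |x|) ^ (-τ)) ^ r) ≤ ENNReal.ofReal (K ^ r * T * ε ^ r) := by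
    calc _ = ∫⁻ x : ℝ, ENNReal.ofReal (K ^ r * ε ^ r) * ENNReal.ofReal (((1 + |x|) ^ (-τ)) ^ r) := by
          congr 1; ext x
          rw [← ENNReal.ofReal_mul (by positivity), Real.mul_rpow (by positivity) (by positivity),
            Real.mul_rpow hK.le hε.le]
      _ = ENNReal.ofReal (K ^ r * ε ^ r) * ∫⁻ x : ℝ, ENNReal.ofReal (((1 + |x|) ^ (-τ)) ^ r) := by
          rw [lintegral_const_mul]; fun_prop
      _ ≤ ENNReal.ofReal (K ^ r * ε ^ r) * ENNReal.ofReal T := by gcongr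
      _ = _ := by
          rw [← ENNReal.ofReal_mul (by positivity)]; congr 1; ring
  have hP0 : 0 < P := lt_of_lt_of_le (by positivity) hP
  have h1b : 0 < (1 - b)⁻¹ := inv_pos.2 (by linarith)
  rw [add_mul, add_mul, ENNReal.ofReal_add (by positivity) (by positivity),
    ENNReal.ofReal_add (by positivity) (by positivity)]
  exact add_le_add (add_le_add e1 e2) e3

theorem log_cost {ls r X : ℝ} (hls : 0 < ls) (hr : 1 ≤ r) (hX : 0 < X) : ∃ C > 0, ∀ ε : ℝ, 0 < ε → ε ≤ 1 →
    ∀ J : ℕ, (J : ℝ) ≤ Real.log (1/ε) / ls + 1 →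
    ((J : ℝ) + 1) * (Real.log (X + 1) + J * Real.log 2 + (r + 1) * Real.log (1/ε)) ≤
      C * ε ^ (-(1:ℝ)/2) := by
  have hlX : 0 ≤ Real.log (X + 1) := Real.log_nonneg (by linarith)
  have hl2 : 0 ≤ Real.log 2 := Real.log_nonneg (by norm_num)
  refine ⟨(4 / ls + 2) * (Real.log (X+1) + (4 / ls + 1) * Real.log 2 + 4 * (r + 1)), by positivity, ?_⟩
  intro ε hε hε1 J hJ
  set u := ε ^ (-(1:ℝ)/4) with hu
  have hu1 : 1 ≤ u := Real.one_le_rpow_of_pos_of_le_one_of_nonpos hε hε1 (by norm_num)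
  have huu : u * u = ε ^ (-(1:ℝ)/2) := by
    rw [hu, ← Real.rpow_add hε]; norm_num
  have hL : Real.log (1/ε) ≤ 4 * u := by
    have := Real.log_le_rpow_div (x := 1/ε) (by positivity) (ε := 1/4) (by norm_num)
    refine this.trans (le_of_eq ?_)
    rw [hu, one_div, Real.inv_rpow hε.le, ← Real.rpow_neg hε.le]
    norm_num; ring_nf
  have hJ1 : (J : ℝ) ≤ (4 / ls + 1) * u := by
    have : Real.log (1/ε) / ls ≤ 4 * u / ls := by gcongr
    have e : 4 * u / ls = 4 / ls * u := by ring
    linarith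
  have hJ2 : (J : ℝ) + 1 ≤ (4 / ls + 2) * u := by linarith
  have hΛ : 0 ≤ Real.log (1/ε) := Real.log_nonneg (by rw [le_div_iff₀ hε]; linarith)
  have hbr : Real.log (X + 1) + J * Real.log 2 + (r + 1) * Real.log (1/ε) ≤
      (Real.log (X+1) + (4 / ls + 1) * Real.log 2 + 4 * (r + 1)) * u := by
    have h1 : Real.log (X+1) ≤ Real.log (X+1) * u := by nlinarith
    have h2 : J * Real.log 2 ≤ ((4 / ls + 1) * u) * Real.log 2 := by gcongr
    have h3 : (r + 1) * Real.log (1/ε) ≤ (r+1) * (4 * u) := by gcongr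
    linarith
  calc _ ≤ ((4 / ls + 2) * u) * ((Real.log (X+1) + (4 / ls + 1) * Real.log 2 + 4 * (r + 1)) * u) := by
        gcongr
    _ = _ := by rw [← huu]; ring

theorem thmR {A B c D α r : ℝ} (hc : 0 < c) (hD : 0 < D) (hr : 1 ≤ r) (hα : 1 / r < α)
    {G : EReal → ℝ} (hG : GH G B D α) : ∃ C > 0, ∀ ε : ℝ, 0 < ε → ε ≤ 1 →
    ∃ W : (ℝ → EReal) → ℝ → ℝ≥0∞, (∀ φ x, W φ x ≠ ⊤) ∧ (∀ φ, Measurable (W φ)) ∧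
      (∀ φ ∈ Phi A B c, ∫⁻ x, W φ x ≤ ENNReal.ofReal (C * ε ^ r)) ∧
      Col (Phi A B c) (fun φ φ' => ∀ x, 0 ≤ x →
        ENNReal.ofReal (|G (φ x) - G (φ' x)| ^ r) ≤ W φ x) (C * ε ^ (-(1:ℝ)/2)) := by
  have hr0 : 0 < r := by linarith
  have hir : 0 < 1 / r := by positivity
  have hα0 : 0 < α := hir.trans hα
  have hαr : 1 < α * r := by rwa [div_lt_iff₀ hr0] at hα
  set H := max 1 (B + 1 - A) with hHdef
  have hH : 1 ≤ H := le_max_left _ _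
  have hHA : B + 1 - H ≤ A := by linarith [le_max_right 1 (B + 1 - A)]
  set κ := (α - 1 / r) / 2 with hκdef
  have hκ : 0 < κ := by rw [hκdef]; linarith
  have hκα : κ < α := by rw [hκdef]; linarith
  set s := (2:ℝ) ^ κ with hs
  have hs1 : 1 < s := Real.one_lt_rpow (by norm_num) hκ
  have hs0 : 0 < s := by linarith
  set a := (2:ℝ) ^ (-α) with ha
  have ha0 : 0 < a := by positivity
  set d := 1 / (4 * r) with hd
  have hd0 : 0 < d := by positivity
  have hdr : d * r = 1 / 4 := by rw [hd]; field_simp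
  have hd4 : d ≤ 1 / 4 := by
    rw [hd]; apply one_div_le_one_div_of_le <;> linarith
  have hb : (s * a) ^ r * 2 < 1 := by
    have : (s * a) ^ r * 2 = (2:ℝ) ^ ((κ - α) * r + 1) := by
      rw [hs, ha, ← Real.rpow_add (by norm_num), ← Real.rpow_mul (by norm_num),
        Real.rpow_add (by norm_num), Real.rpow_one, ← sub_eq_add_neg]
    rw [this]
    apply Real.rpow_lt_one_of_one_lt_of_neg (by norm_num)
    have : (κ - α) * r + 1 = (1 - α * r) / 2 := by rw [hκdef]; field_simp; ring
    rw [this]; linarith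
  have hτ : 1 < (α - κ) * r := by
    have : (α - κ) * r = (α * r + 1) / 2 := by rw [hκdef]; field_simp; ring
    rw [this]; linarith
  obtain ⟨T, hT0, hT⟩ := tail_int hτ
  obtain ⟨C1, hC1, hcol⟩ := piece_col hc hH hHA hD hα0 hd0 hd4 hG
  set ls := Real.log s with hls
  have hls0 : 0 < ls := Real.log_pos hs1
  set X := H / c with hX
  have hX0 : 0 < X := by rw [hX]; positivity
  obtain ⟨C2, hC2, hlog⟩ := log_cost hls0 hr hX0
  set K := D * 2 ^ α + D * c ^ (-α) with hK
  have hK0 : 0 < K := by positivity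
  set P := 1 / ls + 2 with hP
  set C3 := C1 ^ r * (6 * (H / c)) * (1 - (s * a) ^ r * 2)⁻¹ + 2 * D ^ r * P + K ^ r * T with hC3
  have h1b : 0 < (1 - (s * a) ^ r * 2)⁻¹ := inv_pos.2 (by linarith)
  have hC30 : 0 < C3 := by positivity
  set w := s ^ (-(1:ℝ)/2) with hw
  have hw0 : 0 ≤ w := by positivity
  have hw1 : w < 1 := Real.rpow_lt_one_of_one_lt_of_neg hs1 (by norm_num)
  set C4 := C1 * (1 - w)⁻¹ with hC4
  have hC40 : 0 < C4 := by
    have : 0 < (1 - w)⁻¹ := inv_pos.2 (by linarith)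
    positivity
  refine ⟨C2 + C3 + C4, by positivity, ?_⟩
  intro ε hε hε1
  set ρ := ε ^ r * ε with hρ
  have hρ0 : 0 < ρ := by positivity
  have hρ1 : ρ ≤ 1 := mul_le_one₀ (Real.rpow_le_one hε.le hε1 hr0.le) hε.le hε1
  set Λ := Real.log (1/ε) with hΛ
  have hΛ0 : 0 ≤ Λ := Real.log_nonneg (by rw [le_div_iff₀ hε]; linarith)
  set J := ⌈Λ / ls⌉₊ with hJ
  have hJu : (J : ℝ) ≤ Λ / ls + 1 := (Nat.ceil_lt_add_one (by positivity)).le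
  have hJl : 1 / ε ≤ s ^ J := by
    rw [← Real.log_le_log_iff (by positivity) (by positivity), Real.log_pow]
    have := Nat.le_ceil (Λ / ls)
    rwa [div_le_iff₀ hls0] at this
  have hJP : ((J : ℝ) + 1) * ε ≤ P := by
    have h1 : Λ * ε ≤ 1 := by
      have : Λ ≤ 1 / ε := Real.log_le_self (by positivity)
      rwa [le_div_iff₀ hε] at this
    calc ((J : ℝ) + 1) * ε ≤ (Λ / ls + 2) * ε :=
          mul_le_mul_of_nonneg_right (by linarith) hε.le
      _ = (Λ * ε) / ls + 2 * ε := by ring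
      _ ≤ 1 / ls + 2 * 1 := by gcongr
      _ = P := by rw [hP]; ring
  refine ⟨WW B H ρ C1 ε s a d r D K (α - κ) J, fun φ x => WW_ne_top B H ρ C1 ε s a d r D K (α - κ) J φ x,
    fun φ => WW_measurable B H ρ C1 ε s a d r D K (α - κ) J φ,
    ?_, ?_⟩
  · intro φ hφ
    refine (WW_int hc hH hHA hρ0 le_rfl hC1 hε hs0 ha0 hdr hD hK0 hb hJP hT0 hT hφ).trans ?_
    apply ENNReal.ofReal_le_ofReal
    exact mul_le_mul_of_nonneg_right (by linarith) (by positivity)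
  -- the coloring
  set L := Real.log (X + 1) + J * Real.log 2 + (r + 1) * Λ with hL
  have hLexp : Real.exp L = (X + 1) * 2 ^ J / ρ := by
    have : L = Real.log ((X + 1) * 2 ^ J / ρ) := by
      rw [Real.log_div (by positivity) (by positivity), Real.log_mul (by positivity) (by positivity),
        Real.log_pow, hρ, Real.log_mul (by positivity) (by positivity), Real.log_rpow hε, hL, hΛ,
        one_div, Real.log_inv]
      ring
    rw [this, Real.exp_log (by positivity)]
  have hcodes := Col.forall_lt (F := Phi A B c)
    (R := fun k φ φ' => aC B H ρ φ k = aC B H ρ φ' k) (L := fun _ => L) (J + 1) (by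
      intro k hk
      refine Col.floor (A := X * 2 ^ J / ρ) (fun φ => xs B H φ k / ρ) ?_ ?_
      · intro φ hφ
        refine ⟨div_nonneg (xs_nonneg hc hH hHA hφ k) hρ0.le, ?_⟩
        gcongr
        refine (xs_le hc hH hHA hφ k).trans ?_
        gcongr
        · norm_num
        · omega
      · rw [hLexp]
        have : 1 ≤ (2:ℝ) ^ J / ρ := by
          rw [le_div_iff₀ hρ0]
          have : (1:ℝ) ≤ 2 ^ J := one_le_pow₀ (by norm_num)
          linarith
        have e : (X + 1) * 2 ^ J / ρ = X * 2 ^ J / ρ + 2 ^ J / ρ := by ring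
        linarith)
  have hpieces := Col.forall_lt (F := Phi A B c) J (fun j _ => hcol ρ hρ0 (ε * s ^ j) (by positivity) j)
  refine (hcodes.and hpieces).mono ?_ ?_
  · have h1 : ∑ k ∈ Finset.range (J+1), L ≤ C2 * ε ^ (-(1:ℝ)/2) := by
      rw [Finset.sum_const, Finset.card_range, nsmul_eq_mul]
      push_cast
      exact hlog ε hε hε1 J hJu
    have h2 : ∑ k ∈ Finset.range J, C1 * (ε * s ^ k) ^ (-(1:ℝ)/2) ≤ C4 * ε ^ (-(1:ℝ)/2) := by
      have : ∀ k, C1 * (ε * s ^ k) ^ (-(1:ℝ)/2) = C1 * ε ^ (-(1:ℝ)/2) * w ^ k := by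
        intro k
        rw [Real.mul_rpow hε.le (by positivity), hw, ← Real.rpow_natCast, ← Real.rpow_natCast,
          ← Real.rpow_mul hs0.le, ← Real.rpow_mul hs0.le, mul_comm (k : ℝ)]
        ring
      rw [Finset.sum_congr rfl (fun k _ => this k), ← Finset.mul_sum, hC4]
      have h3 := geo_le hw0 hw1 J
      calc _ ≤ C1 * ε ^ (-(1:ℝ)/2) * (1 - w)⁻¹ := by gcongr
        _ = _ := by ring
    have h4 : 0 ≤ C3 * ε ^ (-(1:ℝ)/2) := by positivity
    linarith
  · intro φ hφ φ' hφ' hR x hx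
    obtain ⟨hR1, hR2⟩ := hR
    rcases coverage (B := B) (H := H) hρ0 φ hx J with ⟨j, hj, hxj⟩ | ⟨j, hj, hxj⟩ | hxj
    · have := hR2 j hj ⟨hR1 j (by omega), hR1 (j+1) (by omega)⟩ x hxj
      unfold WW
      refine le_trans ?_ (le_self_add.trans le_self_add)
      refine le_trans ?_ (Finset.single_le_sum (fun _ _ => zero_le) (Finset.mem_range.2 hj))
      rw [Set.indicator_of_mem hxj]
      apply ENNReal.ofReal_le_ofReal
      exact Real.rpow_le_rpow (abs_nonneg _) this hr0.le
    · unfold WW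
      refine le_trans ?_ le_self_add
      refine le_trans ?_ le_add_self
      refine le_trans ?_ (Finset.single_le_sum (fun _ _ => zero_le) (Finset.mem_range.2 hj))
      rw [Set.indicator_of_mem hxj]
      apply ENNReal.ofReal_le_ofReal
      refine Real.rpow_le_rpow (abs_nonneg _) ?_ hr0.le
      have e1 := envelope hc hD hα0 hG hφ x
      have e2 := envelope hc hD hα0 hG hφ' x
      rw [abs_le]; constructor <;> linarith [e1.1, e1.2.1, e2.1, e2.2.1]
    · unfold WW
      refine le_trans ?_ le_add_self
      apply ENNReal.ofReal_le_ofReal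
      refine Real.rpow_le_rpow (abs_nonneg _) ?_ hr0.le
      have e1 := envelope hc hD hα0 hG hφ x
      have e2 := envelope hc hD hα0 hG hφ' x
      have t1 := tail_bound hc hH hHA hD hκ hκα hG hρ0 hε J hJl hφ hxj
      rw [hR1 J (by omega)] at hxj
      have t2 := tail_bound hc hH hHA hD hκ hκα hG hρ0 hε J hJl hφ' hxj
      rw [abs_le]; constructor <;> linarith [e1.1, e2.1]

theorem brackR_of_col {X : Type*} {F : Set X} {val : X → ℝ → ℝ} {W : X → ℝ → ℝ≥0∞} {r L ε : ℝ}
    (hr : 0 < r) (hε : 0 < ε) (hW : ∀ a x, W a x ≠ ⊤)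
    (hI : ∀ a ∈ F, ∫⁻ x, W a x ≤ ENNReal.ofReal ((ε / 2) ^ r))
    (hcol : Col F (fun a b => ∀ x, ENNReal.ofReal (|val a x - val b x| ^ r) ≤ W a x) L) (hL : 0 ≤ L) :
    ∃ N : ℕ, BrackR {f | ∃ a ∈ F, ∀ x, f x = val a x} ε r N ∧ Real.log N ≤ L := by
  classical
  obtain ⟨c, h1, h2⟩ := hcol
  set N := ⌊Real.exp L⌋₊ with hN
  refine ⟨N, ?_, ?_⟩
  swap
  · have : (N : ℝ) ≤ Real.exp L := Nat.floor_le (Real.exp_pos _).le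
    rcases Nat.eq_zero_or_pos N with h | h
    · rw [h]; simpa using hL
    · rw [Real.log_le_iff_le_exp (by exact_mod_cast h)]; exact this
  have hchoice : ∀ i : Fin N, ∃ lu : (ℝ → ℝ) × (ℝ → ℝ),
      (∫⁻ x, ENNReal.ofReal (|lu.2 x - lu.1 x| ^ r) ≤ ENNReal.ofReal (ε ^ r)) ∧
      ∀ b ∈ F, c b = i → ∀ x, lu.1 x ≤ val b x ∧ val b x ≤ lu.2 x := by
    intro i
    by_cases h : ∃ a ∈ F, c a = i
    · obtain ⟨a, ha, hca⟩ := h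
      refine ⟨(fun x => val a x - (W a x).toReal ^ (1/r), fun x => val a x + (W a x).toReal ^ (1/r)), ?_, ?_⟩
      · calc _ = ∫⁻ x, ENNReal.ofReal (2 ^ r) * W a x := by
              congr 1; ext x
              have e : val a x + (W a x).toReal ^ (1/r) - (val a x - (W a x).toReal ^ (1/r)) =
                2 * (W a x).toReal ^ (1/r) := by ring
              simp only [e]
              rw [abs_of_nonneg (by positivity), Real.mul_rpow (by norm_num) (by positivity),
                ← Real.rpow_mul (by positivity), one_div_mul_cancel hr.ne', Real.rpow_one,
                ENNReal.ofReal_mul (by positivity), ENNReal.ofReal_toReal (hW a x)]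
          _ = ENNReal.ofReal (2 ^ r) * ∫⁻ x, W a x := lintegral_const_mul' _ _ ENNReal.ofReal_ne_top
          _ ≤ ENNReal.ofReal (2 ^ r) * ENNReal.ofReal ((ε / 2) ^ r) := by gcongr; exact hI a ha
          _ = _ := by
              rw [← ENNReal.ofReal_mul (by positivity), ← Real.mul_rpow (by norm_num) (by positivity)]
              congr 2; ring
      · intro b hb hcb x
        have := h2 a ha b hb (hca.trans hcb.symm) x
        rw [ENNReal.ofReal_le_iff_le_toReal (hW a x)] at this
        have h3 : |val a x - val b x| ≤ (W a x).toReal ^ (1/r) := by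
          have h4 := Real.rpow_le_rpow (by positivity) this (by positivity : 0 ≤ 1/r)
          rwa [← Real.rpow_mul (abs_nonneg _), mul_one_div_cancel hr.ne', Real.rpow_one] at h4
        rw [abs_le] at h3
        constructor <;> simp only <;> linarith [h3.1, h3.2]
    · refine ⟨(fun _ => 0, fun _ => 0), ?_, ?_⟩
      · simp [Real.zero_rpow hr.ne']
      · intro b hb hcb
        exact absurd ⟨b, hb, hcb⟩ h
  choose lu hlu using hchoice
  refine ⟨fun i => (lu i).1, fun i => (lu i).2, fun i => (hlu i).1, ?_⟩
  rintro f ⟨b, hb, hf⟩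
  have hlt : c b < N := by
    have := h1 b hb
    have : c b + 1 ≤ N := Nat.le_floor (by push_cast; exact this)
    omega
  refine ⟨⟨c b, hlt⟩, fun x => ?_⟩
  rw [hf x]
  exact (hlu ⟨c b, hlt⟩).2 b hb rfl x

theorem brackPhi {A B c D α r : ℝ} (hc : 0 < c) (hD : 0 < D) (hr : 1 ≤ r) (hα : 1 / r < α)
    {G : EReal → ℝ} (hG : GH G B D α) : ∃ K > 0, ∀ ε > 0, ∃ N : ℕ,
    BrackR {f | ∃ φ ∈ Phi A B c, ∀ x, f x = G (φ x)} ε r N ∧ Real.log N ≤ K * ε ^ (-(1:ℝ)/2) := by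
  have hr0 : 0 < r := by linarith
  have hα0 : 0 < α := lt_trans (by positivity) hα
  have hαr : 1 < α * r := by rwa [div_lt_iff₀ hr0] at hα
  obtain ⟨C, hC, hR⟩ := thmR (A := A) hc hD hr hα hG
  obtain ⟨T, hT0, hT⟩ := tail_int hαr
  set T' := (D * c ^ (-α)) ^ r * T with hT'
  have hT'0 : 0 < T' := by positivity
  set E := 2 * (2 * C + 1) + T' with hE
  have hE0 : 0 < E := by positivity
  have hE1 : 1 ≤ E := by rw [hE]; linarith
  have hEr : ∀ y : ℝ, 1 ≤ y → y ≤ y ^ r := fun y hy => Real.self_le_rpow_of_one_le hy hr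
  refine ⟨2 * C * E ^ ((1:ℝ)/2), by positivity, ?_⟩
  intro ε hε
  by_cases hεE : ε ≤ E
  swap
  · refine ⟨1, ⟨fun _ _ => 0, fun _ x => D * (c * (1 + |x|)) ^ (-α), ?_, ?_⟩, ?_⟩
    · intro i
      calc _ = ∫⁻ x : ℝ, ENNReal.ofReal ((D * c ^ (-α)) ^ r) * ENNReal.ofReal (((1 + |x|) ^ (-α)) ^ r) := by
            congr 1; ext x
            beta_reduce
            rw [sub_zero, abs_of_nonneg (by positivity), ← ENNReal.ofReal_mul (by positivity),
              ← Real.mul_rpow (by positivity) (by positivity), Real.mul_rpow hc.le (by positivity)]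
            congr 2; ring
        _ = ENNReal.ofReal ((D * c ^ (-α)) ^ r) * ∫⁻ x : ℝ, ENNReal.ofReal (((1 + |x|) ^ (-α)) ^ r) :=
            lintegral_const_mul' _ _ ENNReal.ofReal_ne_top
        _ ≤ ENNReal.ofReal ((D * c ^ (-α)) ^ r) * ENNReal.ofReal T := by gcongr
        _ ≤ _ := by
            rw [← ENNReal.ofReal_mul (by positivity)]
            apply ENNReal.ofReal_le_ofReal
            have := hEr ε (by linarith)
            linarith
    · rintro f ⟨φ, hφ, hf⟩
      refine ⟨0, fun x => ?_⟩
      rw [hf x]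
      have := envelope hc hD hα0 hG hφ x
      exact ⟨this.1, this.2.2⟩
    · simp; positivity
  have he0 : 0 < ε / E := by positivity
  obtain ⟨W, hW1, hW2, hW3, hW4⟩ := hR (ε / E) he0 (by rw [div_le_one hE0]; exact hεE)
  have hcol2 := hW4.comap (F := Phi A B c) (fun φ x => φ (-x)) (fun φ hφ => (Phi.neg_comp hφ))
  have hcol : Col (Phi A B c) (fun φ φ' => ∀ x, ENNReal.ofReal (|G (φ x) - G (φ' x)| ^ r) ≤
      W φ x + W (fun x => φ (-x)) (-x)) (C * (ε / E) ^ (-(1:ℝ)/2) + C * (ε / E) ^ (-(1:ℝ)/2)) := by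
    refine (hW4.and hcol2).mono le_rfl ?_
    rintro φ hφ φ' hφ' ⟨h1, h2⟩ x
    rcases le_total 0 x with hx | hx
    · exact (h1 x hx).trans le_self_add
    · have := h2 (-x) (by linarith)
      simp only [neg_neg] at this
      exact this.trans le_add_self
  have hIntg : ∀ φ ∈ Phi A B c, ∫⁻ x, (W φ x + W (fun x => φ (-x)) (-x)) ≤
      ENNReal.ofReal ((ε / 2) ^ r) := by
    intro φ hφ
    rw [lintegral_add_left (hW2 φ)]
    have e : ∫⁻ x, W (fun x => φ (-x)) (-x) = ∫⁻ x, W (fun x => φ (-x)) x :=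
      lintegral_neg_eq_self (μ := volume) (W (fun x => φ (-x)))
    rw [e]
    refine (add_le_add (hW3 φ hφ) (hW3 _ (Phi.neg_comp hφ))).trans ?_
    rw [← ENNReal.ofReal_add (by positivity) (by positivity)]
    apply ENNReal.ofReal_le_ofReal
    have h1 : (2 * (2 * C + 1)) ^ r ≤ E ^ r := Real.rpow_le_rpow (by positivity) (by linarith) hr0.le
    have h2 : 2 * C ≤ (2 * C + 1) ^ r := le_trans (by linarith) (hEr _ (by linarith))
    have h3 : 2 ^ r * (2 * C) ≤ E ^ r := by
      rw [Real.mul_rpow (by norm_num) (by positivity)] at h1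
      refine le_trans ?_ h1
      gcongr
    rw [Real.div_rpow hε.le hE0.le, Real.div_rpow hε.le (by norm_num)]
    rw [mul_div_assoc', ← add_div, div_le_div_iff₀ (by positivity) (by positivity)]
    have : 0 ≤ ε ^ r := by positivity
    nlinarith
  obtain ⟨N, hN1, hN2⟩ := brackR_of_col (val := fun φ x => G (φ x)) hr0 hε
    (fun φ x => ENNReal.add_ne_top.2 ⟨hW1 φ x, hW1 _ _⟩) hIntg hcol (by positivity)
  refine ⟨N, hN1, hN2.trans (le_of_eq ?_)⟩
  rw [Real.div_rpow hε.le hE0.le]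
  have : E ^ (-(1:ℝ)/2) = (E ^ ((1:ℝ)/2))⁻¹ := by
    rw [← Real.rpow_neg hE0.le]; norm_num
  rw [this]; field_simp; ring

theorem ConcaveTransform.ivt (h : ConcaveTransform) {v : ℝ} (hv : 0 < v) :
    ∃ b : ℝ, h.toFun (b : EReal) = ENNReal.ofReal v := by
  obtain ⟨e, he⟩ := mem_range_of_exists_le_of_exists_ge (c := ENNReal.ofReal v) h.cont
    ⟨⊥, by rw [h.map_bot]; exact zero_le⟩ ⟨⊤, by rw [h.map_top]; exact le_top⟩
  induction e using EReal.rec with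
  | bot =>
    rw [h.map_bot] at he
    have := ENNReal.ofReal_pos.2 hv
    rw [← he] at this; exact absurd this (lt_irrefl _)
  | top => rw [h.map_top] at he; exact absurd he.symm ENNReal.ofReal_ne_top
  | coe b => exact ⟨b, he⟩

theorem deriv_bound (g : ConcaveTransform) {α B : ℝ} (hα : 0 < α) (hB : g.toFun (B : EReal) ≠ ⊤)
    (hT1 : ∀ ε > 0, ∃ Y : ℝ, ∀ y : ℝ, y ≤ Y → |g.deriv' y| ≤ ε * |y| ^ (-(α + 1))) :
    ∃ D > 0, ∀ y ≤ B, |g.deriv' y| ≤ D * (B + 1 - y) ^ (-(α+1)) := by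
  obtain ⟨Y, hY⟩ := hT1 1 one_pos
  set Y0 := min Y (-(|B| + 1)) with hY0
  have hfin : ∀ y : ℝ, y ≤ B → g.toFun (y : EReal) ≠ ⊤ := fun y hy =>
    ne_top_of_le_ne_top hB (g.mono (by exact_mod_cast hy))
  obtain ⟨m, hm⟩ := (isCompact_Icc (a := Y0) (b := B)).exists_bound_of_continuousOn
    (g.derivCont.mono (fun y hy => hfin y hy.2))
  have hB0 : Y0 ≤ 0 := (min_le_right _ _).trans (by have := abs_nonneg B; linarith)
  have hBY : 0 < B + 1 - Y0 ∨ B + 1 - Y0 ≤ 0 := lt_or_ge _ _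
  refine ⟨2 ^ (α+1) + |m| * |B + 1 - Y0| ^ (α+1), by positivity, ?_⟩
  intro y hy
  have hpos : 0 < B + 1 - y := by linarith
  have hz : 0 ≤ |m| * |B + 1 - Y0| ^ (α+1) := by positivity
  have hz2 : (0:ℝ) ≤ 2 ^ (α+1) := by positivity
  have hz3 : 0 ≤ (B + 1 - y) ^ (-(α+1)) := by positivity
  by_cases hyY : y ≤ Y0
  · have h1 := hY y (hyY.trans (min_le_left _ _))
    rw [one_mul] at h1
    have h2 : y ≤ -(|B| + 1) := hyY.trans (min_le_right _ _)
    have hyabs : |y| = -y := abs_of_nonpos (hyY.trans hB0)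
    have h3 : (B + 1 - y) / 2 ≤ |y| := by
      rw [hyabs]; have := le_abs_self B; linarith
    have h4 : |y| ^ (-(α+1)) ≤ ((B + 1 - y) / 2) ^ (-(α+1)) :=
      Real.rpow_le_rpow_of_nonpos (by positivity) h3 (by linarith)
    have h5 : ((B + 1 - y) / 2) ^ (-(α+1)) = 2 ^ (α+1) * (B + 1 - y) ^ (-(α+1)) := by
      rw [Real.div_rpow hpos.le (by norm_num), Real.rpow_neg (by norm_num : (0:ℝ) ≤ 2)]
      field_simp
    nlinarith
  · have h1 := hm y ⟨(not_le.1 hyY).le, hy⟩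
    rw [Real.norm_eq_abs] at h1
    have h2 : B + 1 - y ≤ |B + 1 - Y0| := by
      have := le_abs_self (B + 1 - Y0); linarith [not_le.1 hyY]
    have h3 : 1 ≤ |B + 1 - Y0| ^ (α+1) * (B + 1 - y) ^ (-(α+1)) := by
      rw [Real.rpow_neg hpos.le, ← div_eq_mul_inv, le_div_iff₀ (by positivity), one_mul]
      exact Real.rpow_le_rpow hpos.le h2 (by linarith)
    have h4 : |m| ≤ |m| * (|B + 1 - Y0| ^ (α+1) * (B + 1 - y) ^ (-(α+1))) := by
      have := abs_nonneg m; nlinarith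
    have := le_abs_self m
    nlinarith

theorem gh_of_transform (g : ConcaveTransform) {α B : ℝ} (hα : 0 < α) (hB : g.toFun (B : EReal) ≠ ⊤)
    (hT1 : ∀ ε > 0, ∃ Y : ℝ, ∀ y : ℝ, y ≤ Y → |g.deriv' y| ≤ ε * |y| ^ (-(α + 1))) :
    ∃ D > 0, GH (fun y => (g.toFun y).toReal) B D α := by
  obtain ⟨D, hD, hd⟩ := deriv_bound g hα hB hT1
  have hfin : ∀ y : ℝ, y ≤ B → g.toFun (y : EReal) ≠ ⊤ := fun y hy =>
    ne_top_of_le_ne_top hB (g.mono (by exact_mod_cast hy))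
  have hDD : D ≤ D + D / α := by have : 0 < D / α := by positivity
                                 linarith
  have hDD2 : D / α ≤ D + D / α := by linarith
  refine ⟨D + D / α, by positivity, ?_, ?_⟩
  · intro t ht y1 y2 h1 h2
    have := (convex_Iic (B + 1 - t)).norm_image_sub_le_of_norm_hasDerivWithin_le
      (f := fun y : ℝ => (g.toFun (y : EReal)).toReal) (f' := g.deriv') (C := D * t ^ (-(α+1)))
      (x := y2) (y := y1)
      (fun y hy => (g.hasDeriv y (hfin y (by have : y ≤ B + 1 - t := hy
                                             linarith))).hasDerivWithinAt) ?_ h2 h1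
    · rw [Real.norm_eq_abs, Real.norm_eq_abs] at this
      refine this.trans ?_
      gcongr
    · intro y hy
      have hy' : y ≤ B + 1 - t := hy
      refine (hd y (by linarith)).trans ?_
      gcongr ?_ * ?_
      exact Real.rpow_le_rpow_of_nonpos (by linarith) (by linarith) (by linarith)
  · set Fn : ℝ → ℝ := fun y => (g.toFun (y : EReal)).toReal - D / α * (B + 1 - y) ^ (-α) with hFn
    have hFd : ∀ y ≤ B, HasDerivAt Fn (g.deriv' y - D * (B + 1 - y) ^ (-(α+1))) y := by
      intro y hy
      have h1 : HasDerivAt (fun y : ℝ => B + 1 - y) (-1) y := by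
        simpa using (hasDerivAt_id y).const_sub (B + 1)
      have h2 := h1.rpow_const (p := -α) (Or.inl (by linarith))
      have h3 := (g.hasDeriv y (hfin y hy)).sub (h2.const_mul (D / α))
      refine HasDerivAt.congr_deriv (f := Fn) h3 ?_
      have : -α - 1 = -(α + 1) := by ring
      rw [this]; field_simp
    have hanti : AntitoneOn Fn (Set.Iic B) := by
      refine antitoneOn_of_deriv_nonpos (convex_Iic B)
        (fun y hy => (hFd y hy).continuousAt.continuousWithinAt)
        (fun y hy => (hFd y (show y ∈ Set.Iic B from interior_subset hy)).differentiableAt.differentiableWithinAt) ?_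
      intro y hy
      have hy' : y ∈ Set.Iic B := interior_subset hy
      replace hy' : y ≤ B := hy'
      rw [(hFd y hy').deriv]
      have := hd y hy'
      have := le_abs_self (g.deriv' y)
      linarith
    have hlim : Tendsto (fun z : ℝ => (g.toFun (z : EReal)).toReal) atBot (nhds 0) := by
      have h1 : Tendsto (fun z : ℝ => (z : EReal)) atBot (nhds ⊥) :=
        EReal.tendsto_coe_nhds_bot_iff.2 tendsto_id
      have h2 := (g.cont.tendsto ⊥).comp h1
      rw [g.map_bot] at h2
      have := (ENNReal.tendsto_toReal ENNReal.zero_ne_top).comp h2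
      simpa [Function.comp_def] using this
    have hbd : ∀ y : ℝ, y ≤ B → (g.toFun (y : EReal)).toReal ≤ D / α * (B + 1 - y) ^ (-α) := by
      intro y hy
      have : Fn y ≤ 0 := by
        refine ge_of_tendsto hlim ?_
        filter_upwards [eventually_le_atBot y] with z hz
        refine (hanti (hz.trans hy) hy hz).trans ?_
        have : 0 ≤ D / α * (B + 1 - z) ^ (-α) := by
          have : 0 < B + 1 - z := by linarith
          positivity
        simp only [hFn]; linarith
      simp only [hFn] at this; linarith
    intro t ht y hy
    refine ⟨ENNReal.toReal_nonneg, ?_⟩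
    have h1 := hbd (B + 1 - t) (by linarith)
    have e : B + 1 - (B + 1 - t) = t := by ring
    rw [e] at h1
    refine (ENNReal.toReal_mono (hfin _ (by linarith)) (g.mono hy)).trans (h1.trans ?_)
    gcongr

theorem side_bound {φ : ℝ → EReal} (hφ : ConcaveE φ) {a0 a1 B x0 : ℝ} (hx0 : 0 < x0)
    (hB : ∀ x, φ x ≤ (B : EReal))
    (h0 : (a1 : EReal) ≤ φ 0) (h1 : φ x0 ≤ (a0 : EReal)) {x : ℝ} (hx : x0 ≤ x) :
    φ x ≤ ((a1 - (a1 - a0) / x0 * x : ℝ) : EReal) := by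
  have hxp : 0 < x := by linarith
  set θ := x0 / x with hθ
  have hθ0 : 0 < θ := by positivity
  have hθ1 : θ ≤ 1 := by rw [hθ, div_le_one hxp]; exact hx
  have h2 := hφ 0 x θ hθ0.le hθ1
  have e : (1 - θ) * 0 + θ * x = x0 := by rw [hθ]; field_simp; ring
  rw [e] at h2
  have h3 := h2.trans h1
  by_cases hbot : φ x = ⊥
  · rw [hbot]; exact bot_le
  have hrx : ((φ x).toReal : EReal) = φ x :=
    EReal.coe_toReal (ne_top_of_le_ne_top (EReal.coe_ne_top _) (hB x)) hbot
  have hr0 : ((φ 0).toReal : EReal) = φ 0 :=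
    EReal.coe_toReal (ne_top_of_le_ne_top (EReal.coe_ne_top _) (hB 0))
      (ne_bot_of_le_ne_bot (EReal.coe_ne_bot _) h0)
  rw [← hrx, ← hr0] at h3
  rw [← hr0] at h0
  rw [← hrx]
  have h4 : (1 - θ) * (φ 0).toReal + θ * (φ x).toReal ≤ a0 := by exact_mod_cast h3
  have h5 : a1 ≤ (φ 0).toReal := by exact_mod_cast h0
  have h6 : (φ x).toReal ≤ a1 - (a1 - a0) / x0 * x := by
    have h7 : θ * (φ x).toReal ≤ a0 - (1 - θ) * a1 := by nlinarith
    have h8 : (φ x).toReal ≤ (a0 - (1 - θ) * a1) / θ := by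
      rw [le_div_iff₀ hθ0]; linarith
    refine h8.trans (le_of_eq ?_)
    rw [hθ]; field_simp; ring
  exact_mod_cast h6

theorem far_point (h : ConcaveTransform) {φ : ℝ → EReal} (hφ : ConcaveE φ) {a0 M x0 : ℝ} (hM : 0 < M)
    (ha0 : h.toFun (a0 : EReal) = ENNReal.ofReal (1 / (2 * M))) (hx0 : 2 * M < x0)
    (h0 : (a0 : EReal) ≤ φ 0) (hIntg : ∫⁻ x, h.toFun (φ x) ≤ 1) : φ x0 ≤ (a0 : EReal) := by
  by_contra hcon
  have hx00 : 0 < x0 := by linarith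
  have h1 : ∀ x ∈ Set.Icc 0 x0, ENNReal.ofReal (1 / (2 * M)) ≤ h.toFun (φ x) := by
    intro x hx
    rw [← ha0]
    exact h.mono (hφ.quasi h0 (not_le.1 hcon).le hx.1 hx.2)
  have h2 : ENNReal.ofReal (1 / (2 * M)) * volume (Set.Icc 0 x0) ≤ 1 := by
    rw [← setLIntegral_const]
    exact (setLIntegral_mono' measurableSet_Icc h1).trans ((setLIntegral_le_lintegral _ _).trans hIntg)
  rw [Real.volume_Icc, ← ENNReal.ofReal_mul (by positivity), ENNReal.ofReal_le_one] at h2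
  rw [sub_zero, one_div_mul_eq_div, div_le_one (by positivity)] at h2
  linarith

theorem mem_Phi (h : ConcaveTransform) {M B a0 a1 x0 : ℝ} (hM : 0 < M)
    (hB : h.toFun (B : EReal) = ENNReal.ofReal (M + 1))
    (ha1 : h.toFun (a1 : EReal) = ENNReal.ofReal (3 / (4 * M)))
    (ha0 : h.toFun (a0 : EReal) = ENNReal.ofReal (1 / (2 * M)))
    (h01 : a0 < a1) (hx0 : 2 * M < x0) {φ : ℝ → EReal} (hφ : ConcaveE φ)
    (hIntg : ∫⁻ x, h.toFun (φ x) = 1) (hle : ∀ x, h.toFun (φ x) ≤ ENNReal.ofReal M)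
    (hge : ∀ x : ℝ, |x| ≤ 1 → ENNReal.ofReal (1 / M) ≤ h.toFun (φ x)) :
    φ ∈ Phi a1 B (min ((a1 - a0) / x0) (1 / (1 + x0))) := by
  have hx00 : 0 < x0 := by linarith
  have hφB : ∀ x, φ x ≤ (B : EReal) := by
    intro x
    by_contra hcon
    have := (h.mono (not_le.1 hcon).le).trans (hle x)
    rw [hB, ENNReal.ofReal_le_ofReal_iff hM.le] at this
    linarith
  have hφ0 : (a1 : EReal) ≤ φ 0 := by
    by_contra hcon
    have := (hge 0 (by simp)).trans (h.mono (not_le.1 hcon).le)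
    rw [ha1, ENNReal.ofReal_le_ofReal_iff (by positivity), div_le_div_iff₀ (by positivity) (by positivity)] at this
    linarith
  have ha1B : a1 ≤ B := by exact_mod_cast hφ0.trans (hφB 0)
  have hφ00 : (a0 : EReal) ≤ φ 0 := le_trans (by exact_mod_cast h01.le) hφ0
  have hside : ∀ x, x0 ≤ |x| → φ x ≤ ((a1 - (a1 - a0) / x0 * |x| : ℝ) : EReal) := by
    intro x hx
    rcases le_total 0 x with h' | h'
    · rw [abs_of_nonneg h'] at hx ⊢
      exact side_bound hφ hx00 hφB hφ0 (far_point h hφ hM ha0 hx0 hφ00 hIntg.le) hx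
    · rw [abs_of_nonpos h'] at hx ⊢
      have hIntg2 : ∫⁻ x, h.toFun (φ (-x)) ≤ 1 := by
        rw [← hIntg]
        exact (lintegral_neg_eq_self (μ := volume) (fun x => h.toFun (φ x))).le
      have := side_bound hφ.neg_comp hx00 (fun x => hφB (-x)) (by simpa using hφ0)
        (far_point h hφ.neg_comp hM ha0 hx0 (by simpa using hφ00) hIntg2) hx
      simpa using this
  refine ⟨hφ, hφB, hφ0, fun x => ?_⟩
  set c := min ((a1 - a0) / x0) (1 / (1 + x0)) with hc
  have hc1 : c ≤ (a1 - a0) / x0 := min_le_left _ _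
  have hc2 : c ≤ 1 / (1 + x0) := min_le_right _ _
  have hc0 : 0 < c := lt_min (div_pos (by linarith) hx00) (by positivity)
  rw [le_div_iff₀ (by positivity)] at hc2
  by_cases hx : x0 ≤ |x|
  · refine (hside x hx).trans ?_
    have : a1 - (a1 - a0) / x0 * |x| ≤ B + 1 - c * (1 + |x|) := by
      have : c * |x| ≤ (a1 - a0) / x0 * |x| := by gcongr
      nlinarith
    exact_mod_cast this
  · refine (hφB x).trans ?_
    have : B ≤ B + 1 - c * (1 + |x|) := by
      have := not_le.1 hx
      nlinarith
    exact_mod_cast this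

/-- Bracketing entropy of `P_{M,h}^{1/2}` in `L_r`: if `g = h^{1/2}` is a
concave-function transformation with `g′(y) = o(|y|^{−(α+1)})` as `y → −∞` for some
`α > 1/r`, satisfying conditions T.2–T.4, then
`log N_{[]}(ε, P_{M,h}^{1/2}, L_r) ≤ K_{r,M,h} ε^{−1/2}` for all `ε > 0`. -/
theorem sqrtPMh_bracketing_entropy (h g : ConcaveTransform) (r M α : ℝ)
    (hr : 1 ≤ r) (hM : 0 < M)
    (hsq : ∀ y : EReal, g.toFun y ^ 2 = h.toFun y)
    (hα : 1 / r < α)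
    (hT1 : ∀ ε > 0, ∃ Y : ℝ, ∀ y : ℝ, y ≤ Y → |g.deriv' y| ≤ ε * |y| ^ (-(α + 1)))
    (hT2 : (∃ y₀ : ℝ, g.toFun (y₀ : EReal) = 0) → ∀ c : ℝ, g.toFun (c : EReal) ≠ ⊤ →
      ∃ Mc : ℝ, ∀ y : ℝ, y ≤ c → g.deriv' y ≤ Mc)
    (hT3 : ∀ yinf : ℝ, (g.toFun (yinf : EReal) = ⊤ ∧
        ∀ y : ℝ, y < yinf → g.toFun (y : EReal) ≠ ⊤) →
      ∃ β > (1 : ℝ), ∃ c C : ℝ, 0 < c ∧ 0 < C ∧ ∃ δ > (0 : ℝ), ∀ y : ℝ,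
        yinf - δ ≤ y → y < yinf →
        ENNReal.ofReal (c * (yinf - y) ^ (-β)) ≤ g.toFun (y : EReal) ∧
        g.toFun (y : EReal) ≤ ENNReal.ofReal (C * (yinf - y) ^ (-β)))
    (hT4 : (∀ y : ℝ, g.toFun (y : EReal) ≠ ⊤) → ∃ γ > (0 : ℝ), ∃ C > (0 : ℝ),
      Tendsto (fun y : ℝ => (g.toFun (y : EReal)).toReal ^ γ *
        (g.toFun ((-(C * y) : ℝ) : EReal)).toReal) atTop (nhds 0)) :
    ∃ K > 0, ∀ ε > 0, ∃ N : ℕ, BrackR (sqrtPMh h M) ε r N ∧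
      Real.log N ≤ K * ε ^ (-(1 : ℝ) / 2) := by
  have hr0 : 0 < r := by linarith
  have hα0 : 0 < α := lt_trans (by positivity) hα
  obtain ⟨B, hB⟩ := h.ivt (v := M + 1) (by linarith)
  obtain ⟨a1, ha1⟩ := h.ivt (v := 3 / (4 * M)) (by positivity)
  obtain ⟨a0, ha0⟩ := h.ivt (v := 1 / (2 * M)) (by positivity)
  have h01 : a0 < a1 := by
    by_contra hcon
    have := h.mono (show (a1 : EReal) ≤ a0 by exact_mod_cast not_lt.1 hcon)
    rw [ha1, ha0, ENNReal.ofReal_le_ofReal_iff (by positivity),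
      div_le_div_iff₀ (by positivity) (by positivity)] at this
    linarith
  have hgB : g.toFun (B : EReal) ≠ ⊤ := by
    intro htop
    have := hsq B
    rw [htop, hB] at this
    simp at this
  obtain ⟨D, hD, hG⟩ := gh_of_transform g hα0 hgB hT1
  have hc0 : 0 < min ((a1 - a0) / (2 * M + 2)) (1 / (1 + (2 * M + 2))) :=
    lt_min (div_pos (by linarith) (by linarith)) (by positivity)
  obtain ⟨K, hK, hmain⟩ := brackPhi (A := a1) hc0 hD hr hα hG
  refine ⟨K, hK, fun ε hε => ?_⟩
  obtain ⟨N, ⟨l, u, h1, h2⟩, hN⟩ := hmain ε hε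
  refine ⟨N, ⟨l, u, h1, ?_⟩, hN⟩
  rintro f ⟨p, ⟨⟨φ, hφ, hp, hIntg⟩, hle, hge⟩, hf⟩
  apply h2
  refine ⟨φ, ?_, ?_⟩
  · refine mem_Phi h hM hB ha1 ha0 h01 (by linarith) hφ ?_ ?_ ?_
    · rw [← hIntg]; congr 1; ext x; rw [hp]
    · intro x; rw [← hp]; exact hle x
    · intro x hx; rw [← hp]; exact hge x hx
  · intro x
    rw [hf, hp, ← hsq, ENNReal.toReal_pow, Real.sqrt_sq ENNReal.toReal_nonneg]
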